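/- Let q be an odd prime power, d ≥ 2, and let Q be a non-degenerate quadratic form on F_q^d, with associated distance φ(x,y) = Q(x−y). Fix t ∈ F_q \ {0} and fix a tree T (a connected acyclic graph) on the vertex set {0,1,…,r}, so T has r edges. For a subset S ⊆ F_q^d, let n_T(S) denote the number of tuples (x_0, x_1, …, x_r) ∈ S^{r+1} such that φ(x_i, x_j) = t for every edge {i,j} of T. Let ε > 0 and let E ⊆ F_q^d with |E| > q^{(d+1)/2 + ε}. Then there exists a subset E* ⊆ E such that |E \ E*| ≤ 2 q^{−2ε/(r+1)} |E| and | n_T(E*) − |E|^{r+1} / q^r | ≤ 8 (|E|^{r+1} / q^r) q^{−2ε/(r+1)}. -/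

import Mathlib

open Finset

namespace KT
open Polynomial

/-- cleared-denominator version of the half trace of `a x + b / x`. -/
noncomputable def gp {L : Type} [Field L] (q h w : ℕ) (a b : L) : L[X] :=
  ∑ i ∈ range h, (C a * X ^ (w + q ^ i) + C b * X ^ (w - q ^ i))

noncomputable def gv {L : Type} [Field L] (q h : ℕ) (a b x : L) : L :=
  ∑ i ∈ range h, (a * x ^ (q ^ i) + b * (x⁻¹) ^ (q ^ i))

lemma gp_eval {L : Type} [Field L] (q h : ℕ) (hq : 1 ≤ q) (a b x : L) (hx : x ≠ 0) :
    (gp q (h + 1) (q ^ h) a b).eval x = x ^ (q ^ h) * gv q (h + 1) a b x := by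
  unfold gp gv
  rw [eval_finsetSum, Finset.mul_sum]
  refine Finset.sum_congr rfl fun i hi => ?_
  have hi' : i ≤ h := by simpa [Nat.lt_succ_iff] using hi
  have hle : q ^ i ≤ q ^ h := Nat.pow_le_pow_right hq hi'
  simp only [eval_add, eval_mul, eval_C, eval_pow, eval_X]
  rw [pow_add, pow_sub₀ x hx hle, inv_pow]
  ring

lemma gp_degree_le {L : Type} [Field L] (q h : ℕ) (hq : 1 ≤ q) (a b : L) :
    (gp q (h + 1) (q ^ h) a b).natDegree ≤ 2 * q ^ h := by
  unfold gp
  refine natDegree_sum_le_of_forall_le _ _ fun i hi => ?_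
  have hi' : i ≤ h := by simpa [Nat.lt_succ_iff] using hi
  have hle : q ^ i ≤ q ^ h := Nat.pow_le_pow_right hq hi'
  refine (natDegree_add_le _ _).trans (max_le ?_ ?_)
  · exact (natDegree_C_mul_X_pow_le _ _).trans (by omega)
  · exact (natDegree_C_mul_X_pow_le _ _).trans (by omega)

lemma gp_coeff {L : Type} [Field L] (q h : ℕ) (hq : 2 ≤ q) (a b : L) :
    (gp q (h + 1) (q ^ h) a b).coeff (2 * q ^ h) = a := by
  unfold gp
  have hpos : 0 < q ^ h := by positivity
  rw [finsetSum_coeff, Finset.sum_range_succ, Finset.sum_eq_zero]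
  · simp only [coeff_add, coeff_C_mul, coeff_X_pow]
    rw [if_pos (by ring), if_neg (by omega)]; simp
  · intro i hi
    have hlt : q ^ i < q ^ h := Nat.pow_lt_pow_right (by omega) (by simpa using hi)
    simp only [coeff_add, coeff_C_mul, coeff_X_pow]
    rw [if_neg (by omega), if_neg (by omega)]; simp

lemma gp_natDegree {L : Type} [Field L] (q h : ℕ) (hq : 2 ≤ q) (a b : L) (ha : a ≠ 0) :
    (gp q (h + 1) (q ^ h) a b).natDegree = 2 * q ^ h :=
  le_antisymm (gp_degree_le q h (by omega) a b)
    (le_natDegree_of_ne_zero (by rw [gp_coeff q h hq]; exact ha))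

lemma mixed_inj {w q : ℕ} {i j k i' j' k' : ℕ} (hi : i < w) (hi' : i' < w) (hj : j < q) (hj' : j' < q)
    (h : i + w * (j + q * k) = i' + w * (j' + q * k')) : i = i' ∧ j = j' ∧ k = k' := by
  have hw : 0 < w := by omega
  have hq : 0 < q := by omega
  have h1 : i = i' := by
    have := congrArg (· % w) h
    simpa [Nat.add_mul_mod_self_left, Nat.mod_eq_of_lt hi, Nat.mod_eq_of_lt hi'] using this
  subst h1
  have h2 : j + q * k = j' + q * k' := Nat.eq_of_mul_eq_mul_left hw (by omega)
  have h3 : j = j' := by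
    have := congrArg (· % q) h2
    simpa [Nat.add_mul_mod_self_left, Nat.mod_eq_of_lt hj, Nat.mod_eq_of_lt hj'] using this
  subst h3
  exact ⟨rfl, rfl, Nat.eq_of_mul_eq_mul_left hq (by omega)⟩

/-- Stepanov-type bound. -/
theorem stepanov {L : Type} [Field L] [Fintype L] [DecidableEq L] (q h : ℕ) (hq : 3 ≤ q)
    (hfrob : ∀ (n : ℕ) (ι : Type) (S : Finset ι) (f : ι → L),
      (∑ i ∈ S, f i) ^ (q ^ n) = ∑ i ∈ S, (f i) ^ (q ^ n))
    (hL : Fintype.card L = (q ^ (h + 1)) ^ 2)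
    (a b s : L) (ha : a ≠ 0) :
    #{x : L | x ≠ 0 ∧ gv q (h + 1) a b x + (gv q (h + 1) a b x) ^ (q ^ (h + 1)) = s}
      ≤ (q ^ h + 4) * q ^ (h + 1) := by
  classical
  set w := q ^ h with hw
  set R := q ^ (h + 1) with hR
  set M := w + 3 with hM
  have hRw : R = w * q := by rw [hR, hw, pow_succ]
  have hwpos : 0 < w := by rw [hw]; positivity
  set g : L[X] := gp q (h + 1) w a b with hg
  have hgdeg : g.natDegree = 2 * w := gp_natDegree q h (by omega) a b ha
  have hg0 : g ≠ 0 := by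
    intro h0; rw [h0] at hgdeg; simp at hgdeg; omega
  let I := Fin w × Fin q × Fin M
  -- the linear system
  let n := w * R + R + M
  let Pt : I → L[X] := fun u => X ^ (u.1.1 * R + u.2.2.1 + (q - 1 - u.2.1.1) * w) *
    (C s * X ^ w - g) ^ u.2.1.1
  have hPt : ∀ u, Pt u ∈ degreeLT L n := by
    rintro ⟨i, j, k⟩
    have hi := i.2; have hj := j.2; have hk := k.2
    rw [mem_degreeLT]
    have hd : (Pt (i, j, k)).natDegree ≤ (i.1 * R + k.1 + (q - 1 - j.1) * w) + j.1 * (2 * w) := by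
      refine natDegree_mul_le.trans (add_le_add (natDegree_X_pow_le _) ?_)
      refine natDegree_pow_le.trans (Nat.mul_le_mul_left _ ?_)
      refine (natDegree_sub_le _ _).trans (max_le ?_ hgdeg.le)
      exact (natDegree_C_mul_X_pow_le _ _).trans (by omega)
    refine degree_le_natDegree.trans_lt ?_
    have : (i.1 * R + k.1 + (q - 1 - j.1) * w) + j.1 * (2 * w) < n := by
      have h1 : (i.1 + 1) * R ≤ w * R := Nat.mul_le_mul_right _ hi
      have h2 : (q - 1 - j.1) * w + j.1 * w + w = R := by
        rw [hRw, ← add_mul, ← Nat.succ_mul, mul_comm w]; congr 1; omega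
      have h3 : j.1 * w + w ≤ R := by omega
      have h4 : j.1 * (2 * w) = j.1 * w + j.1 * w := by ring
      have h5 : (i.1 + 1) * R = i.1 * R + R := by ring
      simp only [n]; omega
    exact_mod_cast lt_of_le_of_lt hd this
  let Φ : (I → L) →ₗ[L] degreeLT L n :=
    Fintype.linearCombination L (fun u => (⟨Pt u, hPt u⟩ : degreeLT L n))
  have hker : LinearMap.ker Φ ≠ ⊥ := by
    have : FiniteDimensional L (degreeLT L n) :=
      Module.Finite.equiv (degreeLTEquiv L n).symm
    apply LinearMap.ker_ne_bot_of_finrank_lt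
    rw [(degreeLTEquiv L n).finrank_eq]
    simp only [Module.finrank_fintype_fun_eq_card, Fintype.card_fin, I, Fintype.card_prod, n]
    rw [← mul_assoc, ← hRw, hM]
    have : 3 * w ≤ R := by rw [hRw, mul_comm]; exact Nat.mul_le_mul_left _ hq
    nlinarith
  obtain ⟨c', hc'ker, hc'0⟩ := (Submodule.ne_bot_iff _).1 hker
  have hP0 : ∑ u, c' u • Pt u = 0 := by
    have h1 : Φ c' = 0 := hc'ker
    have h2 := congrArg (Subtype.val) h1
    simpa [Φ, Fintype.linearCombination_apply] using h2
  have hcard : ∀ x : L, (x ^ R) ^ R = x := by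
    intro x
    rw [← pow_mul, ← pow_two, ← hL]; exact FiniteField.pow_card x
  let c : I → L := fun u => c' u ^ R
  have hcR : ∀ u, c u ^ R = c' u := fun u => hcard _
  let Gt : I → L[X] := fun u => C (c u) * (X ^ (u.1.1 + u.2.2.1 * R + (q - 1 - u.2.1.1) * w) *
    g ^ u.2.1.1)
  have hGdeg : ∀ u, c u ≠ 0 → (Gt u).degree =
      (((q - 1) * w + (u.1.1 + w * (u.2.1.1 + q * u.2.2.1)) : ℕ) : WithBot ℕ) := by
    rintro ⟨i, j, k⟩ hu
    have hj := j.2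
    simp only [Gt]
    rw [degree_C_mul hu, degree_mul, degree_X_pow, degree_pow, degree_eq_natDegree hg0, hgdeg]
    have h2 : (q - 1 - j.1) * w + j.1 * w = (q - 1) * w := by
      rw [← add_mul]; congr 1; omega
    have : i.1 + k.1 * R + (q - 1 - j.1) * w + j.1 * (2 * w) =
      (q - 1) * w + (i.1 + w * (j.1 + q * k.1)) := by
      rw [← h2, hRw]; ring
    rw [← this]; push_cast; simp
  set G : L[X] := ∑ u, Gt u with hG
  have hsum : G.degree = Finset.univ.sup fun u => (Gt u).degree := by
    apply degree_sum_eq_of_disjoint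
    rintro ⟨i, j, k⟩ ⟨-, hu⟩ ⟨i', j', k'⟩ ⟨-, hv⟩ huv hdeg
    have hcu : c (i, j, k) ≠ 0 := fun h0 => hu (by simp [Gt, h0])
    have hcv : c (i', j', k') ≠ 0 := fun h0 => hv (by simp [Gt, h0])
    simp only [Function.comp] at hdeg
    rw [hGdeg _ hcu, hGdeg _ hcv] at hdeg
    have hdeg' : (q - 1) * w + (i.1 + w * (j.1 + q * k.1)) =
      (q - 1) * w + (i'.1 + w * (j'.1 + q * k'.1)) := by exact_mod_cast hdeg
    obtain ⟨h1, h2, h3⟩ := mixed_inj i.2 i'.2 j.2 j'.2 (Nat.add_left_cancel hdeg')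
    exact huv (by ext <;> simp [h1, h2, h3])
  have hG0 : G ≠ 0 := by
    obtain ⟨u, hu⟩ : ∃ u, c' u ≠ 0 := by
      by_contra! hall; exact hc'0 (funext hall)
    have hcu : c u ≠ 0 := pow_ne_zero _ hu
    intro h0
    rw [h0, degree_zero] at hsum
    have : (Gt u).degree ≤ ⊥ := hsum ▸ Finset.le_sup (f := fun u => (Gt u).degree) (Finset.mem_univ u)
    rw [hGdeg u hcu] at this
    exact WithBot.coe_ne_bot (le_bot_iff.1 this)
  have hGnat : G.natDegree ≤ (w + 4) * R := by
    rw [natDegree_le_iff_degree_le, hsum]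
    refine Finset.sup_le fun u _ => ?_
    by_cases hcu : c u = 0
    · simp [Gt, hcu]
    rw [hGdeg u hcu]
    obtain ⟨i, j, k⟩ := u
    have hi := i.2; have hj := j.2; have hk := k.2
    have h1 : w * (j.1 + 1 + q * k.1) ≤ w * (q * M) := by
      apply Nat.mul_le_mul_left
      calc j.1 + 1 + q * k.1 ≤ q + q * k.1 := by omega
        _ = q * (k.1 + 1) := by ring
        _ ≤ q * M := Nat.mul_le_mul_left _ hk
    have h2 : (q - 1) * w ≤ R := by rw [hRw, mul_comm]; exact Nat.mul_le_mul_left _ (by omega)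
    have : (q - 1) * w + (i.1 + w * (j.1 + q * k.1)) ≤ (w + 4) * R := by
      have h3 : w * (q * M) = M * R := by rw [hRw]; ring
      have h4 : (w + 4) * R = M * R + R := by rw [hM]; ring
      have h5 : w * (j.1 + 1 + q * k.1) = w * (j.1 + q * k.1) + w := by ring
      omega
    exact_mod_cast this
  -- all points are roots
  refine le_trans ?_ hGnat
  have hsub : (Finset.univ.filter fun x : L => x ≠ 0 ∧
      gv q (h + 1) a b x + (gv q (h + 1) a b x) ^ R = s) ⊆ G.roots.toFinset := by
    intro x hx
    obtain ⟨hx0, hxs⟩ := (Finset.mem_filter.1 hx).2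
    rw [Multiset.mem_toFinset, mem_roots hG0, IsRoot.def]
    set z := gv q (h + 1) a b x with hz
    have hge : g.eval x = x ^ w * z := gp_eval q h (by omega) a b x hx0
    have hzR : z ^ R = s - z := by rw [← hxs]; ring
    have hkey : ∀ (u : I), ∀ y : L, x ^ ((q - 1 - u.2.1.1) * w) * (x ^ w * y) ^ u.2.1.1 =
        x ^ ((q - 1) * w) * y ^ u.2.1.1 := by
      rintro ⟨i, j, k⟩ y
      have hj := j.2
      have h2 : (q - 1 - j.1) * w + w * j.1 = (q - 1) * w := by
        rw [mul_comm w, ← add_mul]; congr 1; omega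
      rw [mul_pow, ← mul_assoc, ← pow_mul, ← pow_add, h2]
    have hGe : G.eval x = x ^ ((q - 1) * w) *
        ∑ u : I, c u * x ^ (u.1.1) * x ^ (u.2.2.1 * R) * z ^ u.2.1.1 := by
      rw [hG, eval_finsetSum, Finset.mul_sum]
      refine Finset.sum_congr rfl fun u _ => ?_
      simp only [Gt, eval_mul, eval_C, eval_pow, eval_X, hge]
      rw [pow_add x (u.1.1 + _), mul_assoc (x ^ _), hkey, pow_add]; ring
    have hPe : x ^ ((q - 1) * w) *
        ∑ u : I, c' u * x ^ (u.1.1 * R) * x ^ (u.2.2.1) * (s - z) ^ u.2.1.1 = 0 := by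
      have := congrArg (eval x) hP0
      rw [eval_finsetSum, eval_zero] at this
      rw [Finset.mul_sum, ← this]
      refine Finset.sum_congr rfl fun u _ => ?_
      simp only [Pt, eval_smul, smul_eq_mul, eval_mul, eval_C, eval_pow, eval_X, hge, eval_sub]
      rw [show s * x ^ w - x ^ w * z = x ^ w * (s - z) by ring,
        pow_add x (u.1.1 * R + _), mul_assoc (x ^ _), hkey, pow_add]; ring
    have hP' := (mul_eq_zero.1 hPe).resolve_left (pow_ne_zero _ hx0)
    rw [hGe]
    refine mul_eq_zero_of_right _ ?_
    have hRpos : R ≠ 0 := by rw [hR]; positivity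
    rw [← pow_eq_zero_iff hRpos, hR, hfrob, ← hR, ← hP']
    refine Finset.sum_congr rfl fun u _ => ?_
    have e1 : (x ^ (u.2.2.1 * R)) ^ R = x ^ u.2.2.1 := by
      rw [pow_mul, hcard]
    have e2 : (z ^ u.2.1.1) ^ R = (s - z) ^ u.2.1.1 := by
      rw [← pow_mul, mul_comm, pow_mul, hzR]
    rw [mul_pow, mul_pow, mul_pow, hcR, ← pow_mul x u.1.1, e1, e2]
  calc _ ≤ G.roots.toFinset.card := Finset.card_le_card hsub
    _ ≤ Multiset.card G.roots := Multiset.toFinset_card_le _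
    _ ≤ G.natDegree := card_roots' G
end KT

namespace KT

lemma mem_range_of_pow {k L : Type} [Field k] [Fintype k] [Field L] [Algebra k L] (z : L)
    (hz : z ^ Fintype.card k = z) : ∃ x : k, algebraMap k L x = z := by
  classical
  by_contra! hne
  have hinj : Function.Injective (algebraMap k L) := (algebraMap k L).injective
  set P : Polynomial L := Polynomial.X ^ Fintype.card k - Polynomial.X with hP
  have h1 : 1 < Fintype.card k := Fintype.one_lt_card
  have hP0 : P ≠ 0 := FiniteField.X_pow_card_sub_X_ne_zero L h1
  have hdeg : P.natDegree = Fintype.card k := FiniteField.X_pow_card_sub_X_natDegree_eq L h1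
  have hsub : insert z (univ.image (algebraMap k L)) ⊆ P.roots.toFinset := by
    intro y hy
    rw [Multiset.mem_toFinset, Polynomial.mem_roots hP0, Polynomial.IsRoot.def]
    simp only [hP, Polynomial.eval_sub, Polynomial.eval_pow, Polynomial.eval_X]
    rcases Finset.mem_insert.1 hy with rfl | hy
    · rw [hz, sub_self]
    · obtain ⟨x, -, rfl⟩ := Finset.mem_image.1 hy
      rw [← map_pow, FiniteField.pow_card, sub_self]
  have h2 := (Finset.card_le_card hsub).trans
    ((Multiset.toFinset_card_le _).trans (Polynomial.card_roots' P))
  rw [Finset.card_insert_of_notMem, Finset.card_image_of_injective _ hinj, hdeg,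
    Finset.card_univ] at h2
  · omega
  · simpa using hne

lemma frob_sum {k L : Type} [Field k] [Fintype k] [Field L] [Algebra k L] (n : ℕ) (ι : Type)
    (S : Finset ι) (f : ι → L) :
    (∑ i ∈ S, f i) ^ (Fintype.card k ^ n) = ∑ i ∈ S, (f i) ^ (Fintype.card k ^ n) := by
  induction n with
  | zero => simp
  | succ n ih =>
    rw [pow_succ, pow_mul, ih]
    have := map_sum (FiniteField.frobeniusAlgHom k L) (fun i => f i ^ (Fintype.card k ^ n)) S
    simp only [FiniteField.coe_frobeniusAlgHom] at this
    rw [this]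
    exact Finset.sum_congr rfl fun i _ => by rw [← pow_mul]

lemma frob_sub {k L : Type} [Field k] [Fintype k] [Field L] [Algebra k L] (x y : L) :
    (x - y) ^ (Fintype.card k) = x ^ (Fintype.card k) - y ^ (Fintype.card k) := by
  have := map_sub (FiniteField.frobeniusAlgHom k L) x y
  simpa only [FiniteField.coe_frobeniusAlgHom] using this

/-- Kloosterman sum. -/
noncomputable def kl {k : Type} [Field k] [Fintype k] [DecidableEq k] (ψ : AddChar k ℂ) (a b : k) :
    ℂ := ∑ x ∈ univ.filter (fun x : k => x ≠ 0), ψ (a * x + b * x⁻¹)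

/-- counting lemma for quadratic polynomials -/
lemma quad_count {k L : Type} [Field k] [Fintype k] [DecidableEq k] [Field L] [Fintype L]
    [DecidableEq L] [Algebra k L] (hodd : Odd (Fintype.card k))
    (hL : Fintype.card L = Fintype.card k ^ 2) (s p : k) :
    #{x : k × k | (x.1 + x.2, x.1 * x.2) = (s, p)} +
    #{z : L | z + z ^ Fintype.card k = algebraMap k L s ∧
      z * z ^ Fintype.card k = algebraMap k L p} = 2 := by
  set q := Fintype.card k with hq
  set φ := algebraMap k L with hφ
  have hinj : Function.Injective φ := φ.injective
  have hchar : ringChar L ≠ 2 := by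
    intro h2
    have := FiniteField.even_card_of_char_two h2
    rw [hL] at this
    have h3 : Odd (q ^ 2) := hodd.pow
    rw [Nat.odd_iff] at h3; omega
  have h20 : (2 : L) ≠ 0 := Ring.two_ne_zero hchar
  have hφq : ∀ x : k, (φ x) ^ q = φ x := fun x => by rw [← map_pow, hq, FiniteField.pow_card]
  -- a root
  obtain ⟨z0, hz0⟩ : ∃ z : L, z * (φ s - z) = φ p := by
    set D := s ^ 2 - 4 * p with hD
    obtain ⟨w, hw⟩ : ∃ w : L, φ D = w * w := by
      by_cases hD0 : D = 0
      · exact ⟨0, by simp [hD0]⟩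
      · have hφD : φ D ≠ 0 := by simpa using hD0
        apply (FiniteField.isSquare_iff hchar hφD).2
        obtain ⟨m, hm⟩ := hodd
        have hcard : Fintype.card L / 2 = (q - 1) * (m + 1) := by
          rw [hL, hm]
          have : (2 * m + 1) ^ 2 = 2 * ((2 * m + 1 - 1) * (m + 1)) + 1 := by
            rw [Nat.add_sub_cancel]; ring
          omega
        rw [hcard, pow_mul, ← map_pow, hq, FiniteField.pow_card_sub_one_eq_one D hD0]; simp
    refine ⟨(φ s + w) / 2, ?_⟩
    have : φ D = φ s ^ 2 - 4 * φ p := by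
      rw [hD, map_sub, map_mul, map_pow, map_ofNat]
    field_simp
    linear_combination hw - this
  let A1 : Finset L := univ.filter fun z => z ^ q = z ∧ z * (φ s - z) = φ p
  let A2 : Finset L := univ.filter fun z => z ^ q = φ s - z ∧ z * (φ s - z) = φ p
  have e1 : #{x : k × k | (x.1 + x.2, x.1 * x.2) = (s, p)} = #A1 := by
    refine Finset.card_bij (fun x _ => φ x.1) ?_ ?_ ?_
    · rintro ⟨x, y⟩ h
      simp only [mem_filter, mem_univ, true_and, Prod.mk.injEq] at h
      simp only [A1, mem_filter, mem_univ, true_and]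
      refine ⟨hφq x, ?_⟩
      rw [← h.1, ← h.2]; simp
    · rintro ⟨x, y⟩ h ⟨x', y'⟩ h' he
      simp only [mem_filter, mem_univ, true_and, Prod.mk.injEq] at h h'
      have h1 : x = x' := hinj he
      subst h1
      have : y = y' := add_left_cancel (h.1.trans h'.1.symm)
      rw [this]
    · intro z hz
      simp only [A1, mem_filter, mem_univ, true_and] at hz
      obtain ⟨x, rfl⟩ := mem_range_of_pow (k := k) z hz.1
      refine ⟨(x, s - x), ?_, rfl⟩
      simp only [mem_filter, mem_univ, true_and, Prod.mk.injEq]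
      refine ⟨by ring, hinj ?_⟩
      rw [← hz.2]; simp [hφ]
  have e2 : (univ.filter fun z : L => z + z ^ q = φ s ∧ z * z ^ q = φ p) = A2 := by
    ext z
    simp only [A2, mem_filter, mem_univ, true_and]
    constructor
    · rintro ⟨h1, h2⟩
      have : z ^ q = φ s - z := by rw [← h1]; ring
      exact ⟨this, by rw [← this]; exact h2⟩
    · rintro ⟨h1, h2⟩
      rw [h1]; exact ⟨by ring, h2⟩
  rw [e1, e2, ← Finset.card_union_add_card_inter]
  have hroot : ∀ z : L, z * (φ s - z) = φ p ↔ z = z0 ∨ z = φ s - z0 := by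
    intro z
    constructor
    · intro h
      have : (z - z0) * (z - (φ s - z0)) = 0 := by linear_combination hz0 - h
      rcases mul_eq_zero.1 this with h | h
      · exact Or.inl (sub_eq_zero.1 h)
      · exact Or.inr (sub_eq_zero.1 h)
    · rintro (rfl | rfl)
      · exact hz0
      · rw [← hz0]; ring
  have hu : A1 ∪ A2 = {z0, φ s - z0} := by
    ext z
    simp only [A1, A2, mem_union, mem_filter, mem_univ, true_and, mem_insert, mem_singleton]
    rw [← hroot]
    constructor
    · rintro (h | h) <;> exact h.2
    · intro h
      have h2 : z ^ q * (φ s - z ^ q) = φ p := by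
        have := congrArg (· ^ q) h
        simp only [mul_pow, hq, frob_sub] at this
        rwa [← hq, hφq, hφq] at this
      have : (z ^ q - z) * (z ^ q - (φ s - z)) = 0 := by linear_combination h - h2
      rcases mul_eq_zero.1 this with h' | h'
      · exact Or.inl ⟨sub_eq_zero.1 h', h⟩
      · exact Or.inr ⟨sub_eq_zero.1 h', h⟩
  by_cases hd : z0 = φ s - z0
  · have hsz : φ (s / 2) = z0 := by
      rw [map_div₀, map_ofNat]; field_simp; linear_combination -hd
    have hz0q : z0 ^ q = z0 := by rw [← hsz, hφq]
    have hi : A1 ∩ A2 = {z0} := by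
      ext z
      simp only [A1, A2, mem_inter, mem_filter, mem_univ, true_and, mem_singleton]
      constructor
      · rintro ⟨h1, -⟩
        rcases (hroot z).1 h1.2 with h | h
        · exact h
        · rw [h, ← hd]
      · rintro rfl
        exact ⟨⟨hz0q, hz0⟩, ⟨hz0q.trans hd, hz0⟩⟩
    rw [hu, hi, ← hd]; simp
  · have hi : A1 ∩ A2 = ∅ := by
      ext z
      simp only [A1, A2, mem_inter, mem_filter, mem_univ, true_and, notMem_empty, iff_false]
      rintro ⟨h1, h2⟩
      have hz : z = φ s - z := h1.1.symm.trans h2.1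
      rcases (hroot z).1 h1.2 with h | h
      · rw [h] at hz; exact hd hz
      · rw [h] at hz; exact hd (by linear_combination -hz)
    rw [hu, hi, Finset.card_pair hd]; simp

theorem doubling {k L : Type} [Field k] [Fintype k] [DecidableEq k] [Field L] [Fintype L]
    [DecidableEq L] [Algebra k L] (hodd : Odd (Fintype.card k))
    (hfr : Module.finrank k L = 2)
    (hL : Fintype.card L = Fintype.card k ^ 2)
    (ψ : AddChar k ℂ) (hψ : ψ.IsPrimitive) (a b : k) (hb : b ≠ 0) (ha : a ≠ 0) :
    kl (ψ.compAddMonoidHom (Algebra.trace k L).toAddMonoidHom) (algebraMap k L a)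
      (algebraMap k L b) = 2 * (Fintype.card k : ℂ) - (kl ψ a b) ^ 2 := by
  set q := Fintype.card k with hq
  set φ := algebraMap k L with hφ
  have hinj : Function.Injective φ := φ.injective
  have hTr : ∀ z : L, φ (Algebra.trace k L z) = z + z ^ q := by
    intro z
    rw [hφ, FiniteField.algebraMap_trace_eq_sum_pow, hfr, Nat.card_eq_fintype_card]
    simp [Finset.sum_range_succ, hq]
  have hN : ∀ z : L, φ (Algebra.norm k z) = z * z ^ q := by
    intro z
    rw [hφ, FiniteField.algebraMap_norm_eq_prod_pow, hfr, Nat.card_eq_fintype_card]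
    simp [Finset.prod_range_succ, hq]
  let Ψ : k × k → ℂ := fun u => if u.2 = 0 then 0 else ψ (a * u.1 + b * (u.1 / u.2))
  have e1 : (kl ψ a b) ^ 2 = ∑ u : k × k, (#{x : k × k | (x.1 + x.2, x.1 * x.2) = u} : ℂ) * Ψ u := by
    have : (kl ψ a b) ^ 2 = ∑ x : k × k, Ψ (x.1 + x.2, x.1 * x.2) := by
      rw [pow_two, kl, Finset.sum_mul_sum, Fintype.sum_prod_type]
      rw [Finset.sum_filter]
      refine Finset.sum_congr rfl fun x _ => ?_
      by_cases hx : x = 0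
      · simp [hx, Ψ]
      rw [if_pos hx, Finset.sum_filter]
      refine Finset.sum_congr rfl fun y _ => ?_
      by_cases hy : y = 0
      · simp [hy, Ψ]
      simp only [Ψ, mul_eq_zero, hx, hy, or_self, if_false, ne_eq, not_false_eq_true, if_true]
      rw [← AddChar.map_add_eq_mul]
      congr 1
      field_simp
      ring
    rw [this, ← Finset.sum_fiberwise' univ (fun x : k × k => (x.1 + x.2, x.1 * x.2)) Ψ]
    refine Finset.sum_congr rfl fun u _ => ?_
    rw [Finset.sum_const, nsmul_eq_mul]
  have e2 : kl (ψ.compAddMonoidHom (Algebra.trace k L).toAddMonoidHom) (φ a) (φ b) =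
      ∑ u : k × k, (#{z : L | z + z ^ q = φ u.1 ∧ z * z ^ q = φ u.2} : ℂ) * Ψ u := by
    have : kl (ψ.compAddMonoidHom (Algebra.trace k L).toAddMonoidHom) (φ a) (φ b) =
        ∑ z : L, Ψ (Algebra.trace k L z, Algebra.norm k z) := by
      rw [kl, Finset.sum_filter]
      refine Finset.sum_congr rfl fun z _ => ?_
      by_cases hz : z = 0
      · simp [hz, Ψ]
      have hNz : Algebra.norm k z ≠ 0 := by
        intro h0
        have := hN z
        rw [h0, map_zero] at this
        exact (mul_ne_zero hz (pow_ne_zero _ hz)) this.symm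
      simp only [Ψ, hNz, hz, ne_eq, not_false_eq_true, if_true, if_false]
      rw [AddChar.compAddMonoidHom_apply]
      congr 1
      apply hinj
      change φ (Algebra.trace k L _) = _
      rw [map_add (Algebra.trace k L), map_add φ, map_add φ]
      have t1 : Algebra.trace k L (φ a * z) = a * Algebra.trace k L z := by
        rw [hφ, ← Algebra.smul_def, map_smul, smul_eq_mul]
      have t2 : Algebra.trace k L (φ b * z⁻¹) = b * Algebra.trace k L z⁻¹ := by
        rw [hφ, ← Algebra.smul_def, map_smul, smul_eq_mul]
      rw [t1, t2, map_mul φ b, map_mul φ b, map_div₀, hTr, hTr, hN]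
      congr 2
      rw [inv_pow]
      have hzq : z ^ q ≠ 0 := pow_ne_zero _ hz
      field_simp
      ring
    rw [this, ← Finset.sum_fiberwise' univ
      (fun z : L => (Algebra.trace k L z, Algebra.norm k z)) Ψ]
    refine Finset.sum_congr rfl fun u _ => ?_
    rw [Finset.sum_const, nsmul_eq_mul]
    congr 3
    ext z
    obtain ⟨s, p⟩ := u
    simp only [mem_filter, mem_univ, true_and, Prod.mk.injEq, ← hTr, ← hN, hinj.eq_iff]
  have e3 : ∑ u : k × k, Ψ u = q := by
    rw [Fintype.sum_prod_type_right]
    have : ∀ p : k, ∑ s : k, Ψ (s, p) = if p = -(b / a) then (q : ℂ) else 0 := by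
      intro p
      by_cases hp : p = 0
      · have hne : ¬ ((0 : k) = -(b / a)) := by
          intro h; have : b / a = 0 := by simpa using h.symm
          rcases div_eq_zero_iff.1 this with h | h <;> contradiction
        simp [hp, Ψ, ha, hb]
      · have h1 : ∑ s : k, Ψ (s, p) = ∑ s : k, ψ (s * (a + b / p)) := by
          refine Finset.sum_congr rfl fun s _ => ?_
          simp only [Ψ, hp, if_false]; congr 1; ring
        rw [h1, AddChar.sum_mulShift _ hψ]
        have : a + b / p = 0 ↔ p = -(b / a) := by
          constructor
          · intro h; field_simp at h ⊢; linear_combination h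
          · rintro rfl; field_simp; ring
        simp only [this]
        split_ifs <;> simp [hq]
    rw [Finset.sum_congr rfl fun p _ => this p]
    simp
  have e4 : (kl ψ a b) ^ 2 + kl (ψ.compAddMonoidHom (Algebra.trace k L).toAddMonoidHom) (φ a) (φ b)
      = 2 * q := by
    rw [e1, e2, ← Finset.sum_add_distrib, ← e3, Finset.mul_sum]
    refine Finset.sum_congr rfl fun u _ => ?_
    have := quad_count (k := k) (L := L) hodd hL u.1 u.2
    rw [← add_mul]
    congr 1
    exact_mod_cast this
  linear_combination e4
end KT

namespace KT

theorem kl_crude {k L : Type} [Field k] [Fintype k] [DecidableEq k] [Field L] [Fintype L]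
    [DecidableEq L] [Algebra k L] (hq3 : 3 ≤ Fintype.card k) (h : ℕ)
    (hfr : Module.finrank k L = 2 * (h + 1))
    (hL : Fintype.card L = (Fintype.card k ^ (h + 1)) ^ 2)
    (ψ : AddChar k ℂ) (hψ : ψ.IsPrimitive) (a b : k) (ha : a ≠ 0) :
    ‖kl (ψ.compAddMonoidHom (Algebra.trace k L).toAddMonoidHom) (algebraMap k L a)
      (algebraMap k L b)‖ ≤ 5 * (Fintype.card k : ℝ) * (Fintype.card k : ℝ) ^ (h + 1) := by
  set q := Fintype.card k with hq
  set φ := algebraMap k L with hφ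
  set R := q ^ (h + 1) with hR
  have hinj : Function.Injective φ := φ.injective
  have hφa : φ a ≠ 0 := by simpa using ha
  have hφpow : ∀ (x : k) (n : ℕ), (φ x) ^ (q ^ n) = φ x := fun x n => by
    rw [← map_pow, hq, FiniteField.pow_card_pow]
  have hfrob : ∀ (n : ℕ) (ι : Type) (S : Finset ι) (f : ι → L),
      (∑ i ∈ S, f i) ^ (q ^ n) = ∑ i ∈ S, (f i) ^ (q ^ n) := fun n ι S f => frob_sum n ι S f
  have hadd : ∀ (n : ℕ) (x y : L), (x + y) ^ (q ^ n) = x ^ (q ^ n) + y ^ (q ^ n) := by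
    intro n x y
    have := hfrob n (Fin 2) univ ![x, y]
    simpa [Fin.sum_univ_two] using this
  have hTr : ∀ x : L, φ (Algebra.trace k L (φ a * x + φ b * x⁻¹)) =
      gv q (h + 1) (φ a) (φ b) x + (gv q (h + 1) (φ a) (φ b) x) ^ R := by
    intro x
    rw [hφ, FiniteField.algebraMap_trace_eq_sum_pow, hfr, Nat.card_eq_fintype_card, ← hq, ← hφ,
      two_mul, Finset.sum_range_add]
    unfold gv
    rw [hR, hfrob]
    congr 1
    · refine Finset.sum_congr rfl fun i _ => ?_
      rw [hadd, mul_pow, mul_pow, hφpow, hφpow]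
    · refine Finset.sum_congr rfl fun i _ => ?_
      rw [hadd, hadd, mul_pow, mul_pow, mul_pow, mul_pow, hφpow, hφpow, hφpow, hφpow, pow_add q,
        ← pow_mul, ← pow_mul, mul_comm (q ^ i)]
  let N : k → ℕ := fun s => #{x ∈ univ.filter (fun x : L => x ≠ 0) |
    Algebra.trace k L (φ a * x + φ b * x⁻¹) = s}
  have hN : ∀ s, N s ≤ (q ^ h + 4) * R := by
    intro s
    refine le_trans (le_of_eq ?_) (stepanov q h hq3 hfrob hL (φ a) (φ b) (φ s) hφa)
    simp only [N]
    congr 1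
    ext x
    simp only [mem_filter, mem_univ, true_and]
    rw [← hR, ← hTr, hinj.eq_iff]
  have hNsum : ∑ s, N s = Fintype.card L - 1 := by
    simp only [N]
    rw [← Finset.card_eq_sum_card_fiberwise (fun _ _ => by simp)]
    rw [Finset.filter_ne', Finset.card_erase_of_mem (mem_univ _), Finset.card_univ]
  set B : ℕ := (q ^ h + 4) * R with hB
  have hkl : kl (ψ.compAddMonoidHom (Algebra.trace k L).toAddMonoidHom) (φ a) (φ b) =
      ∑ s, (N s : ℂ) * ψ s := by
    rw [kl]
    have := Finset.sum_fiberwise' (univ.filter (fun x : L => x ≠ 0))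
      (fun x => Algebra.trace k L (φ a * x + φ b * x⁻¹)) (fun s => ψ s)
    simp only [Finset.sum_const, nsmul_eq_mul] at this
    rw [this]
    exact Finset.sum_congr rfl fun x _ => rfl
  have hψ0 : ∑ s, ψ s = 0 := by
    have := AddChar.sum_mulShift (1 : k) hψ
    simpa using this
  have hkl2 : kl (ψ.compAddMonoidHom (Algebra.trace k L).toAddMonoidHom) (φ a) (φ b) =
      - ∑ s, ((B : ℂ) - N s) * ψ s := by
    rw [hkl]; simp_rw [sub_mul]
    rw [Finset.sum_sub_distrib, ← Finset.mul_sum, hψ0]; ring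
  rw [hkl2, norm_neg]
  have hbound : ‖∑ s, ((B : ℂ) - N s) * ψ s‖ ≤ ∑ s : k, ((B : ℝ) - N s) := by
    refine (norm_sum_le _ _).trans (Finset.sum_le_sum fun s _ => ?_)
    rw [norm_mul, AddChar.norm_apply, mul_one]
    have : ((B : ℂ) - N s) = (((B : ℝ) - N s : ℝ) : ℂ) := by push_cast; rfl
    rw [this, Complex.norm_real, Real.norm_of_nonneg]
    have := hN s
    have : (N s : ℝ) ≤ B := by exact_mod_cast this
    linarith
  refine hbound.trans ?_
  rw [Finset.sum_sub_distrib, Finset.sum_const, Finset.card_univ, ← hq, nsmul_eq_mul,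
    ← Nat.cast_sum, hNsum, hL]
  have hR1 : 1 ≤ R := Nat.one_le_pow _ _ (by omega)
  have hR2 : 1 ≤ R ^ 2 := Nat.one_le_pow _ _ hR1
  rw [Nat.cast_sub hR2, hB]
  have hR3 : (q : ℝ) ^ h * q = R := by rw [hR]; push_cast; rw [pow_succ]
  have hRr : (1 : ℝ) ≤ R := by exact_mod_cast hR1
  have hqr : (3 : ℝ) ≤ q := by exact_mod_cast hq3
  have hR4 : ((q : ℝ)) ^ (h + 1) = R := by rw [hR]; push_cast; rfl
  rw [hR4]
  push_cast
  have : (q : ℝ) * (((q : ℝ) ^ h + 4) * R) = R ^ 2 + 4 * q * R := by rw [← hR3]; ring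
  rw [this]
  nlinarith

/-- iterated doubling sequence -/
noncomputable def seqS (q : ℕ) (s0 : ℂ) : ℕ → ℂ
  | 0 => s0
  | j + 1 => 2 * (q : ℂ) ^ (2 ^ j) - (seqS q s0 j) ^ 2

theorem tower {k : Type} [Field k] [Fintype k] [DecidableEq k] (hodd : Odd (Fintype.card k))
    (ψ : AddChar k ℂ) (hψ : ψ.IsPrimitive) (a b : k) (ha : a ≠ 0) (hb : b ≠ 0) (j : ℕ) :
    ∃ (L : Type) (_ : Field L) (_ : Fintype L) (_ : DecidableEq L) (_ : Algebra k L),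
      Fintype.card L = Fintype.card k ^ (2 ^ j) ∧ Module.finrank k L = 2 ^ j ∧
      kl (ψ.compAddMonoidHom (Algebra.trace k L).toAddMonoidHom) (algebraMap k L a)
        (algebraMap k L b) = seqS (Fintype.card k) (kl ψ a b) j := by
  induction j with
  | zero =>
    refine ⟨k, inferInstance, inferInstance, inferInstance, inferInstance, by simp, by simp, ?_⟩
    have : ψ.compAddMonoidHom (Algebra.trace k k).toAddMonoidHom = ψ := by
      ext x; simp [AddChar.compAddMonoidHom_apply]
    rw [this]; rfl
  | succ j ih =>
    obtain ⟨L, _, _, _, _, hcard, hfr, hkl⟩ := ih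
    classical
    obtain ⟨p, hp⟩ := CharP.exists L
    have hpp : Fact p.Prime := ⟨CharP.char_is_prime L p⟩
    let M := FiniteField.Extension L p 2
    let : Fintype M := Fintype.ofFinite M
    let : Algebra k M := ((algebraMap L M).comp (algebraMap k L)).toAlgebra
    have : IsScalarTower k L M := IsScalarTower.of_algebraMap_eq' rfl
    have hMfr : Module.finrank L M = 2 := FiniteField.finrank_extension L p 2
    have hMcard : Fintype.card M = Fintype.card L ^ 2 := by
      have := FiniteField.natCard_extension L p 2
      simpa only [Nat.card_eq_fintype_card] using this
    have : FiniteDimensional k L := Module.Finite.of_finite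
    have : FiniteDimensional L M := Module.Finite.of_finite
    refine ⟨M, inferInstance, inferInstance, inferInstance, inferInstance, ?_, ?_, ?_⟩
    · rw [hMcard, hcard, ← pow_mul, pow_succ]
    · rw [← Module.finrank_mul_finrank k L M, hMfr, hfr, pow_succ]
    · have hoddL : Odd (Fintype.card L) := by rw [hcard]; exact hodd.pow
      set ψ' := ψ.compAddMonoidHom (Algebra.trace k L).toAddMonoidHom with hψ'
      have hprim : ψ'.IsPrimitive := by
        apply AddChar.IsPrimitive.of_ne_one
        intro h1
        obtain ⟨x, hx⟩ : ∃ x, ψ x ≠ 1 := by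
          by_contra! hall
          have := hψ one_ne_zero
          apply this
          ext x; simp [hall]
        obtain ⟨y, hy⟩ := Algebra.trace_surjective k L x
        have := congrArg (fun f : AddChar L ℂ => f y) h1
        simp only [hψ', AddChar.compAddMonoidHom_apply] at this
        apply hx
        rw [← hy]
        simpa using this
      have hd := doubling (k := L) (L := M) hoddL hMfr hMcard ψ' hprim (algebraMap k L a)
        (algebraMap k L b) (by simpa using hb) (by simpa using ha)
      have hcomp : ψ'.compAddMonoidHom (Algebra.trace L M).toAddMonoidHom =
          ψ.compAddMonoidHom (Algebra.trace k M).toAddMonoidHom := by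
        ext x
        simp only [hψ', AddChar.compAddMonoidHom_apply]
        congr 1
        exact Algebra.trace_trace x
      rw [hcomp, hkl] at hd
      rw [IsScalarTower.algebraMap_apply k L M a, IsScalarTower.algebraMap_apply k L M b, hd, seqS,
        hcard]
      push_cast; rfl

/-- Weil bound for Kloosterman sums. -/
theorem weil {k : Type} [Field k] [Fintype k] [DecidableEq k] (hodd : Odd (Fintype.card k))
    (ψ : AddChar k ℂ) (hψ : ψ.IsPrimitive) (a b : k) (ha : a ≠ 0) (hb : b ≠ 0) :
    ‖kl ψ a b‖ ≤ 2 * Real.sqrt (Fintype.card k) := by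
  set q := Fintype.card k with hq
  have hq3 : 3 ≤ q := by
    have : 1 < q := Fintype.one_lt_card
    obtain ⟨m, hm⟩ := hodd; omega
  have hq0 : (0 : ℝ) < q := by exact_mod_cast (by omega : 0 < q)
  have hs0 : 0 < Real.sqrt q := Real.sqrt_pos.2 hq0
  set S := seqS q (kl ψ a b) with hS
  by_contra! hcon
  set e : ℝ := ‖kl ψ a b‖ / Real.sqrt q - 2 with he
  have he0 : 0 < e := by
    rw [he, sub_pos, lt_div_iff₀ hs0]; exact hcon
  have hgrow : ∀ j : ℕ, (2 + 4 ^ j * e) * (Real.sqrt q) ^ (2 ^ j) ≤ ‖S j‖ := by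
    intro j
    induction j with
    | zero =>
      simp only [hS, seqS, pow_zero, one_mul, pow_one, he]
      field_simp; linarith
    | succ j ih =>
      set Z := (Real.sqrt q) ^ (2 ^ j) with hZ
      have hZ0 : 0 < Z := by positivity
      have hZ2 : Z ^ 2 = (q : ℝ) ^ (2 ^ j) := by
        rw [hZ, ← pow_mul, mul_comm, pow_mul, Real.sq_sqrt hq0.le]
      have hZ3 : (Real.sqrt q) ^ (2 ^ (j + 1)) = Z ^ 2 := by
        rw [hZ, ← pow_mul, pow_succ]
      have h1 : ‖S (j + 1)‖ ≥ ‖S j‖ ^ 2 - 2 * Z ^ 2 := by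
        have : S (j + 1) = 2 * (q : ℂ) ^ (2 ^ j) - (S j) ^ 2 := rfl
        rw [this, ← norm_pow, norm_sub_rev]
        have h2 : ‖(2 * (q : ℂ) ^ (2 ^ j))‖ = 2 * Z ^ 2 := by
          rw [hZ2]; simp
        rw [← h2]
        exact norm_sub_norm_le _ _
      have h4 : (0 : ℝ) ≤ 4 ^ j * e := by positivity
      have h3 : ((2 + 4 ^ j * e) * Z) ^ 2 ≤ ‖S j‖ ^ 2 :=
        pow_le_pow_left₀ (by positivity) ih 2
      rw [hZ3, pow_succ]
      have h5 : (0 : ℝ) ≤ (4 ^ j * e) ^ 2 * Z ^ 2 := by positivity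
      nlinarith
  have hub : ∀ j : ℕ, ‖S (j + 1)‖ ≤ 5 * q * (Real.sqrt q) ^ (2 ^ (j + 1)) := by
    intro j
    obtain ⟨L, _, _, _, _, hcard, hfr, hkl⟩ := tower hodd ψ hψ a b ha hb (j + 1)
    obtain ⟨h, hh⟩ : ∃ h, 2 ^ j = h + 1 :=
      ⟨2 ^ j - 1, (Nat.succ_pred_eq_of_pos (by positivity)).symm⟩
    have := kl_crude (k := k) (L := L) hq3 h (by rw [hfr, pow_succ, hh]; ring)
      (by rw [hcard, pow_succ, hh, pow_mul]) ψ hψ a b ha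
    rw [hkl] at this
    have h2 : (Real.sqrt q) ^ (2 ^ (j + 1)) = (q : ℝ) ^ (h + 1) := by
      rw [pow_succ, mul_comm, pow_mul, Real.sq_sqrt hq0.le, hh]
    rw [h2]; exact this
  obtain ⟨n, hn⟩ := pow_unbounded_of_one_lt (5 * q / e) (by norm_num : (1 : ℝ) < 4)
  have h1 := (hgrow (n + 1)).trans (hub n)
  have h2 := le_of_mul_le_mul_right h1 (by positivity)
  have h3 : 5 * q < 4 ^ n * e := by rwa [div_lt_iff₀ he0] at hn
  have h4 : (4 : ℝ) ^ (n + 1) * e = 4 * (4 ^ n * e) := by ring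
  nlinarith
end KT

namespace KT

/-- Quadratic character with complex values. -/
noncomputable def chi (F : Type) [Field F] [Fintype F] [DecidableEq F] : MulChar F ℂ :=
  (quadraticChar F).ringHomComp (Int.castRingHom ℂ)

section
variable {F : Type} [Field F] [Fintype F] [DecidableEq F]

lemma chi_apply (x : F) : chi F x = ((quadraticChar F x : ℤ) : ℂ) := rfl

lemma char_ne_two (hodd : Odd (Fintype.card F)) : ringChar F ≠ 2 := by
  intro h
  have := (FiniteField.even_card_iff_char_two (F := F)).1 h
  rcases hodd with ⟨m, hm⟩
  omega

lemma chi_sq {x : F} (hx : x ≠ 0) : chi F x * chi F x = 1 := by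
  have := quadraticChar_sq_one hx
  rw [chi_apply, ← Int.cast_mul, ← sq, this]; simp

lemma chi_norm {x : F} (hx : x ≠ 0) : ‖chi F x‖ = 1 := by
  have h : ‖chi F x‖ * ‖chi F x‖ = 1 := by rw [← norm_mul, chi_sq hx, norm_one]
  nlinarith [norm_nonneg (chi F x)]

lemma chi_inv {x : F} : chi F x⁻¹ = chi F x := by
  by_cases hx : x = 0
  · simp [hx]
  have h1 : chi F x⁻¹ * chi F x = 1 := by
    rw [← map_mul, inv_mul_cancel₀ hx, map_one]
  have h2 := chi_sq hx
  have h3 : chi F x ≠ 0 := by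
    intro h; rw [h] at h2; simp at h2
  exact mul_right_cancel₀ h3 (h1.trans h2.symm)

lemma chi_ne_one (hodd : Odd (Fintype.card F)) : chi F ≠ 1 := by
  intro h
  obtain ⟨a, ha⟩ := quadraticChar_exists_neg_one' (char_ne_two hodd)
  have h1 : chi F (a : F) = 1 := by rw [h]; simp
  rw [chi_apply, ha] at h1
  norm_num at h1

lemma norm_gauss (hodd : Odd (Fintype.card F)) {ψ : AddChar F ℂ} (hψ : ψ.IsPrimitive) :
    ‖gaussSum (chi F) ψ‖ = Real.sqrt (Fintype.card F) := by
  have hq : (chi F).IsQuadratic := (quadraticChar_isQuadratic F).comp _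
  have h := gaussSum_sq (chi_ne_one hodd) hq hψ
  have h2 : ‖gaussSum (chi F) ψ‖ ^ 2 = Fintype.card F := by
    rw [← norm_pow, h, norm_mul, chi_norm (by simp)]; simp
  rw [← h2, Real.sqrt_sq (norm_nonneg _)]

lemma sum_shift {ψ : AddChar F ℂ} (hψ : ψ.IsPrimitive) {c : F} (hc : c ≠ 0) :
    ∑ x : F, ψ (c * x) = 0 := by
  have := AddChar.sum_mulShift c hψ
  simp only [hc, if_false, Nat.cast_zero] at this
  simpa [mul_comm] using this

lemma gauss_shift (ψ : AddChar F ℂ) {c : F} (hc : c ≠ 0) :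
    ∑ a : F, chi F a * ψ (c * a) = chi F c * gaussSum (chi F) ψ := by
  have h := gaussSum_mulShift (chi F) ψ (Units.mk0 c hc)
  rw [← h, ← mul_assoc]
  simp only [Units.val_mk0]
  rw [chi_sq hc, one_mul]
  simp [gaussSum, AddChar.mulShift_apply]

lemma quad_gauss (hodd : Odd (Fintype.card F)) {ψ : AddChar F ℂ} (hψ : ψ.IsPrimitive) {c : F}
    (hc : c ≠ 0) : ∑ z : F, ψ (c * z ^ 2) = chi F c * gaussSum (chi F) ψ := by
  rw [← gauss_shift ψ hc]
  have h1 : ∑ z : F, ψ (c * z ^ 2) =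
      ∑ a : F, ∑ z ∈ univ.filter (fun z : F => z ^ 2 = a), ψ (c * z ^ 2) :=
    (Finset.sum_fiberwise univ (fun z : F => z ^ 2) _).symm
  rw [h1]
  have h2 : ∀ a : F, ∑ z ∈ univ.filter (fun z : F => z ^ 2 = a), ψ (c * z ^ 2)
      = chi F a * ψ (c * a) + ψ (c * a) := by
    intro a
    have h3 : ∑ z ∈ univ.filter (fun z : F => z ^ 2 = a), ψ (c * z ^ 2) =
        ∑ z ∈ univ.filter (fun z : F => z ^ 2 = a), ψ (c * a) := by
      apply Finset.sum_congr rfl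
      intro z hz
      rw [(Finset.mem_filter.1 hz).2]
    rw [h3, Finset.sum_const, nsmul_eq_mul]
    have h4 := quadraticChar_card_sqrts (char_ne_two hodd) a
    have h5 : ({x : F | x ^ 2 = a}.toFinset) = univ.filter (fun z : F => z ^ 2 = a) := by
      ext; simp
    rw [h5] at h4
    have h6 : ((#(univ.filter (fun z : F => z ^ 2 = a)) : ℕ) : ℂ) = chi F a + 1 := by
      rw [chi_apply]; exact_mod_cast congrArg (Int.cast : ℤ → ℂ) h4
    rw [h6]; ring
  rw [Finset.sum_congr rfl (fun a _ => h2 a), Finset.sum_add_distrib, sum_shift hψ hc, add_zero]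

/-- Salie sum. -/
lemma salie (hodd : Odd (Fintype.card F)) {ψ : AddChar F ℂ} (hψ : ψ.IsPrimitive) (a b : F)
    (ha : a ≠ 0) :
    ‖∑ u ∈ univ.filter (fun x : F => x ≠ 0), chi F u * ψ (a * u + b * u⁻¹)‖
      ≤ 2 * Real.sqrt (Fintype.card F) := by
  have hsub : ∀ f : F → ℂ, f 0 = 0 → ∑ u ∈ univ.filter (fun x : F => x ≠ 0), f u = ∑ u, f u := by
    intro f hf
    rw [Finset.sum_filter]
    apply Finset.sum_congr rfl
    intro u _
    by_cases hu : u = 0 <;> simp [hu, hf]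
  have hg := norm_gauss hodd hψ
  by_cases hb : b = 0
  · subst hb
    rw [hsub _ (by simp [chi_apply])]
    simp only [zero_mul, add_zero]
    rw [gauss_shift ψ ha, norm_mul, chi_norm ha, hg]
    have := Real.sqrt_nonneg (Fintype.card F : ℝ)
    linarith
  set g := gaussSum (chi F) ψ
  set q := Fintype.card F with hq
  have hqpos : (0 : ℝ) < q := by
    rw [hq]; exact_mod_cast Fintype.card_pos
  have key : chi F (-b) * g * (∑ u ∈ univ.filter (fun x : F => x ≠ 0),
      chi F u * ψ (a * u + b * u⁻¹)) =
      (q : ℂ) * ∑ z ∈ univ.filter (fun z : F => b * z ^ 2 = a), ψ (-2 * b * z) := by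
    have e1 : ∀ u : F, u ≠ 0 → chi F (-b) * g * (chi F u * ψ (a * u + b * u⁻¹)) =
        ∑ z : F, ψ ((a - b * z ^ 2) * u) * ψ (-2 * b * z) := by
      intro u hu
      have h1 : ∑ z : F, ψ ((-b * u) * (z + u⁻¹) ^ 2) = ∑ z : F, ψ ((-b * u) * z ^ 2) :=
        Fintype.sum_equiv (Equiv.addRight u⁻¹) _ _ (fun z => rfl)
      rw [quad_gauss hodd hψ (by simp [hb, hu]), map_mul] at h1
      calc chi F (-b) * g * (chi F u * ψ (a * u + b * u⁻¹))
          = (chi F (-b) * chi F u * g) * ψ (a * u + b * u⁻¹) := by ring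
        _ = ∑ z : F, ψ ((-b * u) * (z + u⁻¹) ^ 2) * ψ (a * u + b * u⁻¹) := by
            rw [← h1, Finset.sum_mul]
        _ = _ := by
            apply Finset.sum_congr rfl
            intro z _
            rw [← AddChar.map_add_eq_mul, ← AddChar.map_add_eq_mul]
            congr 1
            field_simp
            ring
    rw [Finset.mul_sum, Finset.sum_congr rfl (fun u hu => e1 u (Finset.mem_filter.1 hu).2),
      Finset.sum_comm]
    have e2 : ∀ z : F, ∑ u ∈ univ.filter (fun x : F => x ≠ 0),
        ψ ((a - b * z ^ 2) * u) * ψ (-2 * b * z) =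
        (if b * z ^ 2 = a then (q : ℂ) * ψ (-2 * b * z) else 0) - ψ (-2 * b * z) := by
      intro z
      have h0 : ∑ u ∈ univ.filter (fun x : F => x ≠ 0), ψ ((a - b * z ^ 2) * u) =
          (∑ u : F, ψ ((a - b * z ^ 2) * u)) - 1 := by
        have : univ.filter (fun x : F => x ≠ 0) = univ.erase 0 := by ext; simp
        rw [this, Finset.sum_erase_eq_sub (Finset.mem_univ _)]; simp
      rw [← Finset.sum_mul, h0]
      split_ifs with h
      · simp [h]; ring
      · rw [sum_shift hψ (sub_ne_zero.2 (Ne.symm h))]; ring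
    rw [Finset.sum_congr rfl (fun z _ => e2 z), Finset.sum_sub_distrib,
      sum_shift hψ (c := -2 * b) (by
        have := Ring.two_ne_zero (char_ne_two hodd)
        simp [hb, this]), sub_zero, ← Finset.sum_filter, Finset.mul_sum]
  have hcard : (#(univ.filter (fun z : F => b * z ^ 2 = a)) : ℝ) ≤ 2 := by
    by_cases hne : (univ.filter (fun z : F => b * z ^ 2 = a)).Nonempty
    · obtain ⟨z0, hz0⟩ := hne
      have hs : univ.filter (fun z : F => b * z ^ 2 = a) ⊆ {z0, -z0} := by
        intro z hz
        have h1 := (Finset.mem_filter.1 hz).2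
        have h2 := (Finset.mem_filter.1 hz0).2
        have h3 : z ^ 2 = z0 ^ 2 := mul_left_cancel₀ hb (h1.trans h2.symm)
        simpa using sq_eq_sq_iff_eq_or_eq_neg.1 h3
      exact_mod_cast (Finset.card_le_card hs).trans Finset.card_le_two
    · rw [Finset.not_nonempty_iff_eq_empty.1 hne]; simp
  have hn := congrArg norm key
  rw [norm_mul, norm_mul, chi_norm (by simpa using hb), hg, one_mul, norm_mul] at hn
  have hle : ‖∑ z ∈ univ.filter (fun z : F => b * z ^ 2 = a), ψ (-2 * b * z)‖ ≤ 2 := by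
    refine (norm_sum_le _ _).trans ?_
    simpa using hcard
  have hs : 0 < Real.sqrt (q : ℝ) := Real.sqrt_pos.2 hqpos
  have hss : Real.sqrt (q : ℝ) * Real.sqrt q = q := Real.mul_self_sqrt hqpos.le
  have hnq : ‖(q : ℂ)‖ = q := by simp
  rw [hnq] at hn
  refine le_of_mul_le_mul_left ?_ hs
  rw [hn]
  nlinarith

/-- the sum M(s). -/
lemma M_bound (hodd : Odd (Fintype.card F)) {ψ : AddChar F ℂ} (hψ : ψ.IsPrimitive) (d : ℕ) (a b : F)
    (ha : a ≠ 0) :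
    ‖∑ u ∈ univ.filter (fun x : F => x ≠ 0), chi F u ^ d * ψ (a * u + b * u⁻¹)‖
      ≤ 2 * Real.sqrt (Fintype.card F) := by
  have hc1 : (1 : ℝ) ≤ Real.sqrt (Fintype.card F) := by
    rw [Real.one_le_sqrt]; exact_mod_cast Fintype.card_pos
  rcases Nat.even_or_odd' d with ⟨m, rfl | rfl⟩
  · have e : ∑ u ∈ univ.filter (fun x : F => x ≠ 0), chi F u ^ (2 * m) * ψ (a * u + b * u⁻¹)
        = kl ψ a b := by
      apply Finset.sum_congr rfl
      intro u hu
      rw [pow_mul, sq, chi_sq (Finset.mem_filter.1 hu).2]; simp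
    rw [e]
    by_cases hb : b = 0
    · have : kl ψ a b = -1 := by
        subst hb
        have : univ.filter (fun x : F => x ≠ 0) = univ.erase 0 := by ext; simp
        rw [kl, this, Finset.sum_erase_eq_sub (Finset.mem_univ _)]
        simp only [zero_mul, add_zero]
        rw [sum_shift hψ ha]; simp
      rw [this]; simp; linarith
    · exact weil hodd ψ hψ a b ha hb
  · have e : ∑ u ∈ univ.filter (fun x : F => x ≠ 0), chi F u ^ (2 * m + 1) * ψ (a * u + b * u⁻¹)
        = ∑ u ∈ univ.filter (fun x : F => x ≠ 0), chi F u * ψ (a * u + b * u⁻¹) := by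
      apply Finset.sum_congr rfl
      intro u hu
      rw [pow_succ, pow_mul, sq, chi_sq (Finset.mem_filter.1 hu).2]; simp
    rw [e]
    exact salie hodd hψ a b ha

end
end KT

namespace KT
section
variable {F : Type} [Field F] [Fintype F] [DecidableEq F]

lemma addChar_sum {ι : Type} (ψ : AddChar F ℂ) (s : Finset ι) (f : ι → F) :
    ψ (∑ i ∈ s, f i) = ∏ i ∈ s, ψ (f i) := by
  classical
  induction s using Finset.induction_on with
  | empty => simp
  | insert a s ha ih => rw [Finset.sum_insert ha, Finset.prod_insert ha, AddChar.map_add_eq_mul, ih]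

lemma quad_G (hodd : Odd (Fintype.card F)) {ψ : AddChar F ℂ} (hψ : ψ.IsPrimitive) {d : ℕ}
    (Q : QuadraticForm F (Fin d → F))
    (hQ : ∀ x, (∀ y, QuadraticMap.polar (⇑Q) x y = 0) → x = 0) :
    ∃ G : ℂ, ‖G‖ = Real.sqrt (Fintype.card F) ^ d ∧
      ∀ u : F, u ≠ 0 → ∑ x : Fin d → F, ψ (u * Q x) = chi F u ^ d * G := by
  have h2 : (2 : F) ≠ 0 := Ring.two_ne_zero (char_ne_two hodd)
  let _ : Invertible (2 : F) := invertibleOfNonzero h2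
  have hsep : (QuadraticMap.associated (R := F) Q).SeparatingLeft := by
    intro x hx
    apply hQ
    intro y
    have h3 := hx y
    have h4 := QuadraticMap.two_nsmul_associated F Q
    have h5 : (2 • QuadraticMap.associated (R := F) Q) x y = QuadraticMap.polar Q x y := by
      rw [h4]; rfl
    rw [← h5]
    change (2 • (QuadraticMap.associated (R := F) Q x)) y = 0
    change 2 • (QuadraticMap.associated (R := F) Q x y) = 0
    rw [h3, smul_zero]
  obtain ⟨w, ⟨e⟩⟩ := Q.equivalent_weightedSumSquares_units_of_nondegenerate' hsep
  have hfin : Module.finrank F (Fin d → F) = d := by simp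
  refine ⟨∏ i, (chi F (w i : F) * gaussSum (chi F) ψ), ?_, ?_⟩
  · rw [norm_prod]
    have : ∀ i, ‖chi F (w i : F) * gaussSum (chi F) ψ‖ = Real.sqrt (Fintype.card F) := by
      intro i
      rw [norm_mul, chi_norm (w i).ne_zero, norm_gauss hodd hψ, one_mul]
    rw [Finset.prod_congr rfl (fun i _ => this i)]; simp
  · intro u hu
    have h1 : ∑ x : Fin d → F, ψ (u * Q x) =
        ∑ y : Fin (Module.finrank F (Fin d → F)) → F, ∏ i, ψ (u * (w i : F) * y i ^ 2) := by
      apply Fintype.sum_equiv e.toLinearEquiv.toEquiv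
      intro x
      have h3 : Q x = QuadraticMap.weightedSumSquares F w (e x) := (e.map_app x).symm
      rw [h3, QuadraticMap.weightedSumSquares_apply, Finset.mul_sum, addChar_sum]
      apply Finset.prod_congr rfl
      intro i _
      congr 1
      have : (w i) • (e x i * e x i) = (w i : F) * (e x i * e x i) := rfl
      rw [this]
      change _ = u * (w i : F) * (e x i) ^ 2
      ring
    rw [h1, ← Fintype.prod_sum (fun i z => ψ (u * (w i : F) * z ^ 2))]
    have h3 : ∀ i, ∑ z : F, ψ (u * (w i : F) * z ^ 2) =
        chi F u * (chi F (w i : F) * gaussSum (chi F) ψ) := by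
      intro i
      rw [quad_gauss hodd hψ (mul_ne_zero hu (w i).ne_zero), map_mul]; ring
    simp only [h3]
    rw [Finset.prod_mul_distrib]
    simp

/-- Key identity -/
lemma sphere_identity (hodd : Odd (Fintype.card F)) {ψ : AddChar F ℂ} (hψ : ψ.IsPrimitive) {d : ℕ}
    (Q : QuadraticForm F (Fin d → F))
    (hQ : ∀ x, (∀ y, QuadraticMap.polar (⇑Q) x y = 0) → x = 0) (t : F) (ht : t ≠ 0) :
    ∃ (G : ℂ) (M : (Fin d → F) → ℂ), ‖G‖ = Real.sqrt (Fintype.card F) ^ d ∧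
      (∀ ξ, ‖M ξ‖ ≤ 2 * Real.sqrt (Fintype.card F)) ∧
      ∀ z, G * ((Fintype.card F : ℂ) * (if Q z = t then 1 else 0) - 1) =
        ∑ ξ, M ξ * ψ (QuadraticMap.polar Q z ξ) := by
  obtain ⟨G, hG, hG2⟩ := quad_G hodd hψ Q hQ
  refine ⟨G, fun ξ => chi F (-1) ^ d * ∑ u ∈ univ.filter (fun x : F => x ≠ 0),
    chi F u ^ d * ψ ((-t) * u + (-Q ξ) * u⁻¹), hG, ?_, ?_⟩
  · intro ξ
    rw [norm_mul, norm_pow, chi_norm (by simp), one_pow, one_mul]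
    exact M_bound hodd hψ d _ _ (by simpa using ht)
  · intro z
    have e0 : ((Fintype.card F : ℂ) * (if Q z = t then 1 else 0) - 1) =
        ∑ u ∈ univ.filter (fun x : F => x ≠ 0), ψ ((Q z - t) * u) := by
      have : univ.filter (fun x : F => x ≠ 0) = univ.erase 0 := by ext; simp
      rw [this, Finset.sum_erase_eq_sub (Finset.mem_univ _)]
      split_ifs with h
      · simp [h]
      · rw [sum_shift hψ (sub_ne_zero.2 h)]; simp
    rw [e0, Finset.mul_sum]
    simp only [Finset.mul_sum, Finset.sum_mul]
    rw [Finset.sum_comm]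
    apply Finset.sum_congr rfl
    intro u hu
    have hu0 : u ≠ 0 := (Finset.mem_filter.1 hu).2
    have h1 : ∑ ξ : Fin d → F, ψ ((-u⁻¹) * Q (ξ - u • z)) = ∑ ξ : Fin d → F, ψ ((-u⁻¹) * Q ξ) :=
      Fintype.sum_equiv (Equiv.subRight (u • z)) _ _ (fun z => rfl)
    rw [hG2 _ (by simpa using hu0), ← neg_one_mul, map_mul, chi_inv, mul_pow] at h1
    have hc1 : chi F (-1) ^ d * chi F (-1) ^ d = 1 := by
      rw [← mul_pow, chi_sq (by simp), one_pow]
    have hc2 : chi F u ^ d * chi F u ^ d = 1 := by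
      rw [← mul_pow, chi_sq hu0, one_pow]
    have h2 : G = chi F (-1) ^ d * chi F u ^ d *
        ∑ ξ : Fin d → F, ψ ((-1) * u⁻¹ * Q (ξ - u • z)) := by
      rw [h1]
      calc G = (chi F (-1) ^ d * chi F (-1) ^ d) * (chi F u ^ d * chi F u ^ d) * G := by
            rw [hc1, hc2]; ring
        _ = _ := by ring
    rw [h2, mul_assoc, Finset.sum_mul, Finset.mul_sum]
    apply Finset.sum_congr rfl
    intro ξ _
    rw [← AddChar.map_add_eq_mul, mul_assoc, mul_assoc, mul_assoc, mul_assoc,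
      ← AddChar.map_add_eq_mul]
    congr 3
    have h3 : Q (ξ - u • z) = Q ξ + u * u * Q z - u * QuadraticMap.polar Q z ξ := by
      rw [sub_eq_add_neg, ← neg_smul, QuadraticMap.map_add Q, QuadraticMap.map_smul,
        QuadraticMap.polar_smul_right, QuadraticMap.polar_comm Q ξ z]
      simp; ring
    rw [h3]
    field_simp
    ring

/-- Parseval -/
lemma parseval {ψ : AddChar F ℂ} (hψ : ψ.IsPrimitive) {d : ℕ}
    (Q : QuadraticForm F (Fin d → F))
    (hQ : ∀ x, (∀ y, QuadraticMap.polar (⇑Q) x y = 0) → x = 0) (f : (Fin d → F) → ℝ) :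
    ∑ ξ, ‖∑ x, (f x : ℂ) * ψ (QuadraticMap.polar Q x ξ)‖ ^ 2 =
      (Fintype.card F : ℝ) ^ d * ∑ x, f x ^ 2 := by
  have horth : ∀ v : Fin d → F, ∑ ξ, ψ (QuadraticMap.polar Q v ξ) =
      if v = 0 then (Fintype.card F : ℂ) ^ d else 0 := by
    intro v
    split_ifs with h
    · subst h; simp
    · obtain ⟨y, hy⟩ : ∃ y, QuadraticMap.polar Q v y ≠ 0 := by
        by_contra hcon; push Not at hcon; exact h (hQ v hcon)
      set φ : AddChar (Fin d → F) ℂ :=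
        ψ.compAddMonoidHom ((QuadraticMap.polarBilin Q v).toAddMonoidHom) with hφ
      have hφa : ∀ ξ, φ ξ = ψ (QuadraticMap.polar Q v ξ) := fun ξ => rfl
      have hne : φ ≠ 0 := by
        intro h0
        have h1 := hψ hy
        apply h1
        ext c
        have h2 : φ (c • y) = 1 := by rw [h0]; rfl
        rw [hφa, QuadraticMap.polar_smul_right] at h2
        rw [AddChar.mulShift_apply, mul_comm]
        simpa using h2
      have := AddChar.sum_eq_zero_iff_ne_zero.2 hne
      simpa [hφa] using this
  have hC : ((∑ ξ, ‖∑ x, (f x : ℂ) * ψ (QuadraticMap.polar Q x ξ)‖ ^ 2 : ℝ) : ℂ) =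
      (((Fintype.card F : ℝ) ^ d * ∑ x, f x ^ 2 : ℝ) : ℂ) := by
    push_cast
    calc ∑ ξ, ((‖∑ x, (f x : ℂ) * ψ (QuadraticMap.polar Q x ξ)‖ : ℝ) : ℂ) ^ 2
        = ∑ ξ, ∑ x, ∑ y, (f x : ℂ) * f y * ψ (QuadraticMap.polar Q (x - y) ξ) := by
          apply Finset.sum_congr rfl
          intro ξ _
          rw [← Complex.mul_conj', map_sum, Finset.sum_mul_sum]
          apply Finset.sum_congr rfl
          intro x _
          apply Finset.sum_congr rfl
          intro y _
          rw [map_mul, Complex.conj_ofReal, ← AddChar.map_neg_eq_conj, sub_eq_add_neg,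
            QuadraticMap.polar_add_left, QuadraticMap.polar_neg_left, AddChar.map_add_eq_mul]
          ring
      _ = ∑ x, ∑ y, (f x : ℂ) * f y * (if x - y = 0 then (Fintype.card F : ℂ) ^ d else 0) := by
          rw [Finset.sum_comm]
          apply Finset.sum_congr rfl
          intro x _
          rw [Finset.sum_comm]
          apply Finset.sum_congr rfl
          intro y _
          rw [← Finset.mul_sum, horth]
      _ = _ := by
          rw [Finset.mul_sum]
          apply Finset.sum_congr rfl
          intro x _
          simp only [sub_eq_zero, mul_ite, mul_zero, Finset.sum_ite_eq, Finset.mem_univ, if_true]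
          ring
  exact_mod_cast hC

theorem spectral (hodd : Odd (Fintype.card F)) {d : ℕ}
    (Q : QuadraticForm F (Fin d → F))
    (hQ : ∀ x, (∀ y, QuadraticMap.polar (⇑Q) x y = 0) → x = 0) (t : F) (ht : t ≠ 0)
    (f₁ f₂ : (Fin d → F) → ℝ) :
    |∑ x, ∑ y, f₁ x * f₂ y * ((if Q (x - y) = t then 1 else 0) - 1 / (Fintype.card F : ℝ))| ≤
      2 * Real.sqrt (Fintype.card F) ^ d / Real.sqrt (Fintype.card F) *
        (Real.sqrt (∑ x, f₁ x ^ 2) * Real.sqrt (∑ x, f₂ x ^ 2)) := by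
  obtain ⟨ψ, hψ⟩ : ∃ ψ : AddChar F ℂ, ψ.IsPrimitive := by
    obtain ⟨ψ, hψ⟩ := (AddChar.exists_apply_ne_zero (α := F) (a := 1)).2 one_ne_zero
    refine ⟨ψ, AddChar.IsPrimitive.of_ne_one ?_⟩
    rintro rfl; simp at hψ
  obtain ⟨G, M, hG, hM, hid⟩ := sphere_identity hodd hψ Q hQ t ht
  set q : ℝ := (Fintype.card F : ℝ) with hq
  have hqpos : 0 < q := by rw [hq]; exact_mod_cast Fintype.card_pos
  have hs : 0 < Real.sqrt q := Real.sqrt_pos.2 hqpos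
  have hss : Real.sqrt q * Real.sqrt q = q := Real.mul_self_sqrt hqpos.le
  set A : ℝ := ∑ x, ∑ y, f₁ x * f₂ y * ((if Q (x - y) = t then 1 else 0) - 1 / q) with hA
  set h₁ : (Fin d → F) → ℂ := fun ξ => ∑ x, (f₁ x : ℂ) * ψ (QuadraticMap.polar Q x ξ) with hh₁
  set h₂ : (Fin d → F) → ℂ := fun ξ => ∑ x, (f₂ x : ℂ) * ψ (QuadraticMap.polar Q x ξ) with hh₂
  have hAe : G * (q : ℂ) * (A : ℂ) = ∑ ξ, M ξ * (h₁ ξ * (starRingEnd ℂ) (h₂ ξ)) := by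
    have hqc : (q : ℂ) ≠ 0 := by exact_mod_cast hqpos.ne'
    calc G * (q : ℂ) * (A : ℂ) = ∑ x, ∑ y, (f₁ x : ℂ) * f₂ y *
          (G * ((Fintype.card F : ℂ) * (if Q (x - y) = t then 1 else 0) - 1)) := by
          rw [hA]; push_cast
          rw [Finset.mul_sum]
          apply Finset.sum_congr rfl
          intro x _
          rw [Finset.mul_sum]
          apply Finset.sum_congr rfl
          intro y _
          have : (Fintype.card F : ℂ) = (q : ℂ) := by rw [hq]; push_cast; rfl
          rw [this]
          split_ifs <;> push_cast <;> field_simp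
      _ = ∑ x, ∑ y, ∑ ξ, M ξ * (((f₁ x : ℂ) * ψ (QuadraticMap.polar Q x ξ)) *
            ((f₂ y : ℂ) * ψ (-QuadraticMap.polar Q y ξ))) := by
          apply Finset.sum_congr rfl
          intro x _
          apply Finset.sum_congr rfl
          intro y _
          rw [hid, Finset.mul_sum]
          apply Finset.sum_congr rfl
          intro ξ _
          rw [sub_eq_add_neg, QuadraticMap.polar_add_left, QuadraticMap.polar_neg_left,
            AddChar.map_add_eq_mul]
          ring
      _ = _ := by
          have : ∀ x, ∑ y, ∑ ξ, M ξ * (((f₁ x : ℂ) * ψ (QuadraticMap.polar Q x ξ)) *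
            ((f₂ y : ℂ) * ψ (-QuadraticMap.polar Q y ξ))) =
            ∑ ξ, ∑ y, M ξ * (((f₁ x : ℂ) * ψ (QuadraticMap.polar Q x ξ)) *
            ((f₂ y : ℂ) * ψ (-QuadraticMap.polar Q y ξ))) := fun x => Finset.sum_comm
          simp only [this]
          rw [Finset.sum_comm]
          apply Finset.sum_congr rfl
          intro ξ _
          rw [hh₁, hh₂]
          simp only [map_sum, map_mul, Complex.conj_ofReal, ← AddChar.map_neg_eq_conj]
          rw [Finset.sum_mul_sum, Finset.mul_sum]
          apply Finset.sum_congr rfl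
          intro x _
          rw [Finset.mul_sum]
  have hnorm : Real.sqrt q ^ d * q * |A| ≤
      2 * Real.sqrt q * (q ^ d * (Real.sqrt (∑ x, f₁ x ^ 2) * Real.sqrt (∑ x, f₂ x ^ 2))) := by
    have e1 : Real.sqrt q ^ d * q * |A| = ‖G * (q : ℂ) * (A : ℂ)‖ := by
      rw [norm_mul, norm_mul, hG, Complex.norm_real, Complex.norm_real, Real.norm_eq_abs,
        Real.norm_eq_abs, abs_of_pos hqpos]
    rw [e1, hAe]
    calc ‖∑ ξ, M ξ * (h₁ ξ * (starRingEnd ℂ) (h₂ ξ))‖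
        ≤ ∑ ξ, 2 * Real.sqrt q * (‖h₁ ξ‖ * ‖h₂ ξ‖) := by
          refine (norm_sum_le _ _).trans (Finset.sum_le_sum fun ξ _ => ?_)
          rw [norm_mul, norm_mul, RCLike.norm_conj]
          exact mul_le_mul_of_nonneg_right (hM ξ) (by positivity)
      _ = 2 * Real.sqrt q * ∑ ξ, ‖h₁ ξ‖ * ‖h₂ ξ‖ := by rw [Finset.mul_sum]
      _ ≤ 2 * Real.sqrt q * (Real.sqrt (∑ ξ, ‖h₁ ξ‖ ^ 2) * Real.sqrt (∑ ξ, ‖h₂ ξ‖ ^ 2)) := by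
          apply mul_le_mul_of_nonneg_left _ (by positivity)
          exact Real.sum_mul_le_sqrt_mul_sqrt _ _ _
      _ = _ := by
          rw [parseval hψ Q hQ, parseval hψ Q hQ, ← hq, Real.sqrt_mul (by positivity),
            Real.sqrt_mul (by positivity)]
          have : Real.sqrt (q ^ d) * Real.sqrt (q ^ d) = q ^ d := Real.mul_self_sqrt (by positivity)
          linear_combination 2 * Real.sqrt q * Real.sqrt (∑ x, f₁ x ^ 2) *
            Real.sqrt (∑ x, f₂ x ^ 2) * this
  set S := Real.sqrt (∑ x, f₁ x ^ 2) * Real.sqrt (∑ x, f₂ x ^ 2)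
  have hqd : q ^ d = Real.sqrt q ^ d * Real.sqrt q ^ d := by rw [← mul_pow, hss]
  have hpd : 0 < Real.sqrt q ^ d := by positivity
  rw [div_mul_eq_mul_div, le_div_iff₀ hs]
  refine le_of_mul_le_mul_left ?_ (mul_pos hpd hs)
  calc Real.sqrt q ^ d * Real.sqrt q * (|A| * Real.sqrt q) = Real.sqrt q ^ d * q * |A| := by
        linear_combination Real.sqrt q ^ d * |A| * hss
    _ ≤ _ := hnorm
    _ = _ := by rw [hqd]; ring

end
end KT

namespace KT

/-- symmetric weighted adjacency restricted to `S`. -/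
noncomputable def adj {X : Type} (R : X → X → Prop) (S : Finset X) (u v : X) : ℝ :=
  open Classical in if u ∈ S ∧ v ∈ S ∧ R u v then 1 else 0

/-- indicator of homomorphisms into `S`. -/
noncomputable def homInd {X V : Type} (R : X → X → Prop) (S : Finset X) (T : SimpleGraph V)
    (x : V → X) : ℝ :=
  open Classical in if (∀ i, x i ∈ S) ∧ ∀ i j, T.Adj i j → R (x i) (x j) then 1 else 0

/-- rooted count. -/
noncomputable def rooted {X V : Type} [Fintype X] [Fintype V] [DecidableEq V] [DecidableEq X] (R : X → X → Prop) (S : Finset X)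
    (T : SimpleGraph V) (p : V) (u : X) : ℝ :=
  ∑ x : V → X, homInd R S T x * (if x p = u then 1 else 0)

/-- total count. -/
noncomputable def total {X V : Type} [Fintype X] [Fintype V] [DecidableEq V] [DecidableEq X] (R : X → X → Prop) (S : Finset X)
    (T : SimpleGraph V) : ℝ :=
  ∑ x : V → X, homInd R S T x

section
variable {X : Type} [Fintype X] {R : X → X → Prop} {S : Finset X}

lemma adj_nonneg (u v : X) : 0 ≤ adj R S u v := by
  unfold adj; split_ifs <;> norm_num

lemma adj_symm (hR : ∀ x y, R x y → R y x) (u v : X) : adj R S u v = adj R S v u := by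
  unfold adj
  congr 1
  exact propext ⟨fun h => ⟨h.2.1, h.1, hR _ _ h.2.2⟩, fun h => ⟨h.2.1, h.1, hR _ _ h.2.2⟩⟩

lemma homInd_nonneg {V : Type} (T : SimpleGraph V) (x : V → X) : 0 ≤ homInd R S T x := by
  unfold homInd; split_ifs <;> norm_num

lemma rooted_nonneg [DecidableEq X] {V : Type} [Fintype V] [DecidableEq V] (T : SimpleGraph V) (p : V) (u : X) :
    0 ≤ rooted R S T p u := by
  refine Finset.sum_nonneg fun x _ => mul_nonneg (homInd_nonneg T x) ?_
  split_ifs <;> norm_num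

lemma rooted_zero [DecidableEq X] {V : Type} [Fintype V] [DecidableEq V] (T : SimpleGraph V) (p : V) (u : X) (hu : u ∉ S) :
    rooted R S T p u = 0 := by
  refine Finset.sum_eq_zero fun x _ => ?_
  unfold homInd
  split_ifs with h1 h2
  · exact absurd (h2 ▸ h1.1 p) hu
  all_goals simp

lemma sum_rooted [DecidableEq X] {V : Type} [Fintype V] [DecidableEq V] (T : SimpleGraph V) (p : V) :
    ∑ u, rooted R S T p u = total R S T := by
  unfold rooted total
  rw [Finset.sum_comm]
  refine Finset.sum_congr rfl fun x _ => ?_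
  rw [← Finset.mul_sum]; simp

/-- leaf removal -/
lemma homInd_leaf {V : Type} [DecidableEq V] (hR : ∀ x y, R x y → R y x) (T : SimpleGraph V)
    (l : V) (p : {j // j ≠ l}) (hlp : T.Adj l p) (hu : ∀ y, T.Adj l y → y = p)
    (x : V → X) :
    homInd R S T x = homInd R S (T.comap (Subtype.val : {j // j ≠ l} → V)) (fun j => x j) *
      adj R S (x p) (x l) := by
  unfold homInd adj
  rw [ite_zero_mul_ite_zero, mul_one]
  congr 1
  apply propext
  constructor
  · rintro ⟨h1, h2⟩
    exact ⟨⟨fun i => h1 i, fun i j hij => h2 i j hij⟩, h1 _, h1 _, hR _ _ (h2 _ _ hlp)⟩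
  · rintro ⟨⟨h1, h2⟩, h3, h4, h5⟩
    refine ⟨fun i => ?_, fun i j hij => ?_⟩
    · by_cases hi : i = l
      · subst hi; exact h4
      · exact h1 ⟨i, hi⟩
    · by_cases hi : i = l
      · subst hi
        rw [hu j hij]; exact hR _ _ h5
      · by_cases hj : j = l
        · subst hj
          rw [hu i hij.symm]; exact h5
        · exact h2 ⟨i, hi⟩ ⟨j, hj⟩ hij

lemma sum_leaf {V : Type} [Fintype V] [DecidableEq V] (hR : ∀ x y, R x y → R y x)
    (T : SimpleGraph V)
    (l : V) (p : {j // j ≠ l}) (hlp : T.Adj l p) (hu : ∀ y, T.Adj l y → y = p)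
    (w : X → ({j // j ≠ l} → X) → ℝ) :
    ∑ x : V → X, homInd R S T x * w (x l) (fun j => x j) =
      ∑ y : {j // j ≠ l} → X, homInd R S (T.comap (Subtype.val : {j // j ≠ l} → V)) y *
        ∑ v, adj R S (y p) v * w v y := by
  rw [Fintype.sum_equiv (Equiv.funSplitAt l X) _
    (fun z : X × ({j // j ≠ l} → X) => homInd R S (T.comap (Subtype.val : {j // j ≠ l} → V)) z.2 *
      (adj R S (z.2 p) z.1 * w z.1 z.2))]
  · rw [Fintype.sum_prod_type_right]
    refine Finset.sum_congr rfl fun y _ => ?_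
    rw [Finset.mul_sum]
  · intro x
    rw [homInd_leaf hR T l p hlp hu x, mul_assoc]
    rfl

theorem tree_count [DecidableEq X] (hR : ∀ x y, R x y → R y x) [DecidableRel R] (c lam D : ℝ)
    (hc : 0 ≤ c) (hlam : 0 ≤ lam)
    (hD : ∀ u, ∑ v, adj R S u v ≤ D) (hcD : c * S.card ≤ D)
    (hspec : ∀ f₁ f₂ : X → ℝ, |∑ x, ∑ y, f₁ x * f₂ y * ((if R x y then 1 else 0) - c)| ≤
      lam * (Real.sqrt (∑ x, f₁ x ^ 2) * Real.sqrt (∑ x, f₂ x ^ 2))) (n : ℕ) :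
    ∀ (V : Type) [Fintype V] [DecidableEq V] (T : SimpleGraph V), T.IsTree →
      Fintype.card V = n + 1 →
      (∀ s u, rooted R S T s u ≤ D ^ n) ∧
      |total R S T - (S.card : ℝ) * (c * S.card) ^ n| ≤ n * lam * S.card * D ^ (n - 1) := by
  have hD0 : 0 ≤ D := le_trans (by positivity) hcD
  induction n with
  | zero =>
    intro V _ _ T hT hV
    obtain ⟨hun⟩ := Fintype.card_eq_one_iff_nonempty_unique.1 hV
    have hH : ∀ x : V → X, homInd R S T x = if x default ∈ S then 1 else 0 := by
      intro x
      unfold homInd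
      congr 1
      apply propext
      constructor
      · intro h; exact h.1 _
      · intro h
        refine ⟨fun i => by rw [Subsingleton.elim i default]; exact h, fun i j hij => ?_⟩
        exact absurd (Subsingleton.elim i j) hij.ne
    have hsum : ∀ f : X → ℝ, ∑ x : V → X, f (x default) = ∑ u, f u := fun f =>
      Fintype.sum_equiv (Equiv.funUnique V X) _ _ (fun x => rfl)
    constructor
    · intro s u
      unfold rooted
      simp only [hH, Subsingleton.elim s default]
      have := hsum (fun v => (if v ∈ S then (1 : ℝ) else 0) * (if v = u then 1 else 0))
      rw [this]
      simp; split_ifs <;> norm_num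
    · unfold total
      simp only [hH]
      have := hsum (fun v => (if v ∈ S then (1 : ℝ) else 0))
      have h2 : (∑ x : V → X, if x default ∈ S then (1 : ℝ) else 0) = S.card := by
        rw [this]; simp
      have h3 : (∑ x : V → X, if x default ∈ S then (1 : ℝ) else 0) -
        (S.card : ℝ) * (c * S.card) ^ 0 = 0 := by rw [h2]; simp
      simp at h3 ⊢
      exact h3
  | succ n ih =>
    intro V _ _ T hT hV
    have hnt : Nontrivial V := by
      rw [← Fintype.one_lt_card_iff_nontrivial]; omega
    have : DecidableRel T.Adj := Classical.decRel _
    obtain ⟨l, hl⟩ := hT.exists_vert_degree_one_of_nontrivial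
    obtain ⟨p0, hlp, hup⟩ := SimpleGraph.degree_eq_one_iff_existsUnique_adj.mp hl
    have hp0 : p0 ≠ l := hlp.ne'
    set p : {j // j ≠ l} := ⟨p0, hp0⟩ with hp
    set T' := T.comap (Subtype.val : {j // j ≠ l} → V) with hT'
    have hT'c : T'.Connected := hT.connected.induce_compl_singleton_of_degree_eq_one hl
    have hT'a : T'.IsAcyclic := hT.isAcyclic.induce {l}ᶜ
    have hcard : Fintype.card {j // j ≠ l} = n + 1 := by
      rw [Fintype.card_subtype_compl, hV]; simp
    obtain ⟨ih1, ih2⟩ := ih {j // j ≠ l} T' ⟨hT'c, hT'a⟩ hcard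
    have hleaf := sum_leaf (S := S) hR T l p hlp hup
    have hfiber : ∀ w : X → ℝ, ∑ y : {j // j ≠ l} → X, homInd R S T' y * w (y p) =
        ∑ u, rooted R S T' p u * w u := by
      intro w
      unfold rooted
      simp only [Finset.sum_mul]
      rw [Finset.sum_comm]
      refine Finset.sum_congr rfl fun y _ => ?_
      simp
    constructor
    · intro s u
      by_cases hs : s = l
      · have h1 : rooted R S T s u = ∑ v, rooted R S T' p v * adj R S v u := by
          rw [← hfiber]
          subst hs
          have := hleaf (fun v _ => if v = u then 1 else 0)
          simp only [mul_ite, mul_one, mul_zero, Finset.sum_ite_eq', Finset.mem_univ,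
            if_true] at this
          unfold rooted
          simp only [mul_ite, mul_one, mul_zero]
          exact this
        rw [h1, pow_succ]
        calc ∑ v, rooted R S T' p v * adj R S v u ≤ ∑ v, D ^ n * adj R S v u :=
              Finset.sum_le_sum fun v _ => mul_le_mul_of_nonneg_right (ih1 p v) (adj_nonneg _ _)
          _ = D ^ n * ∑ v, adj R S u v := by
              rw [Finset.mul_sum]
              exact Finset.sum_congr rfl fun v _ => by rw [adj_symm hR]
          _ ≤ D ^ n * D := mul_le_mul_of_nonneg_left (hD u) (by positivity)
      · have h1 : rooted R S T s u = ∑ y : {j // j ≠ l} → X, homInd R S T' y *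
            ((∑ v, adj R S (y p) v) * (if y ⟨s, hs⟩ = u then 1 else 0)) := by
          have := hleaf (fun _ y => if y ⟨s, hs⟩ = u then 1 else 0)
          simp only [Finset.sum_mul]
          unfold rooted
          exact this
        rw [h1, pow_succ]
        calc ∑ y : {j // j ≠ l} → X, homInd R S T' y *
            ((∑ v, adj R S (y p) v) * (if y ⟨s, hs⟩ = u then 1 else 0))
            ≤ ∑ y : {j // j ≠ l} → X, (homInd R S T' y * (if y ⟨s, hs⟩ = u then 1 else 0)) * D := by
              refine Finset.sum_le_sum fun y _ => ?_
              have h2 := hD (y p)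
              have h3 : 0 ≤ homInd R S T' y * (if y ⟨s, hs⟩ = u then 1 else 0) :=
                mul_nonneg (homInd_nonneg _ _) (by split_ifs <;> norm_num)
              nlinarith [mul_le_mul_of_nonneg_left h2 h3]
          _ = rooted R S T' ⟨s, hs⟩ u * D := by
              rw [← Finset.sum_mul]; rfl
          _ ≤ D ^ n * D := mul_le_mul_of_nonneg_right (ih1 _ u) hD0
    · have h1 : total R S T = ∑ u, ∑ v, rooted R S T' p u * (if v ∈ S then 1 else 0) *
          (if R u v then 1 else 0) := by
        have h2 := hleaf (fun _ _ => 1)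
        simp only [mul_one] at h2
        have h3 := hfiber (fun u => ∑ v, adj R S u v)
        have h4 : total R S T = ∑ u, rooted R S T' p u * ∑ v, adj R S u v := by
          rw [← h3, ← h2]; rfl
        rw [h4]
        refine Finset.sum_congr rfl fun u _ => ?_
        rw [Finset.mul_sum]
        refine Finset.sum_congr rfl fun v _ => ?_
        by_cases hu : u ∈ S
        · unfold adj
          by_cases hv : v ∈ S <;> by_cases huv : R u v <;> simp [hu, hv, huv]
        · rw [rooted_zero T' p u hu]; ring
      have h5 := hspec (fun u => rooted R S T' p u) (fun v => if v ∈ S then 1 else 0)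
      have h6 : ∑ u, ∑ v, rooted R S T' p u * (if v ∈ S then 1 else 0) *
          ((if R u v then 1 else 0) - c) = total R S T - total R S T' * (c * S.card) := by
        simp only [mul_sub, Finset.sum_sub_distrib]
        rw [← h1, ← sum_rooted T' p, Finset.sum_mul]
        congr 1
        refine Finset.sum_congr rfl fun u _ => ?_
        rw [← Finset.sum_mul, ← Finset.mul_sum]
        simp; ring
      have h7 : Real.sqrt (∑ u, rooted R S T' p u ^ 2) ≤ Real.sqrt S.card * D ^ n := by
        rw [← Real.sqrt_sq (pow_nonneg hD0 n), ← Real.sqrt_mul (by positivity)]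
        apply Real.sqrt_le_sqrt
        calc ∑ u, rooted R S T' p u ^ 2 ≤ ∑ u, if u ∈ S then (D ^ n) ^ 2 else 0 := by
              refine Finset.sum_le_sum fun u _ => ?_
              split_ifs with hu
              · exact pow_le_pow_left₀ (rooted_nonneg _ _ _) (ih1 p u) 2
              · rw [rooted_zero T' p u hu]; simp
          _ = _ := by simp
      have h8 : Real.sqrt (∑ v, (if v ∈ S then (1 : ℝ) else 0) ^ 2) = Real.sqrt S.card := by
        congr 1; simp
      rw [h6, h8] at h5
      have hss : Real.sqrt (S.card : ℝ) * Real.sqrt S.card = S.card :=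
        Real.mul_self_sqrt (by positivity)
      have h9 : |total R S T - total R S T' * (c * S.card)| ≤ lam * S.card * D ^ n := by
        refine h5.trans ?_
        calc lam * (Real.sqrt (∑ u, rooted R S T' p u ^ 2) * Real.sqrt S.card)
            ≤ lam * ((Real.sqrt S.card * D ^ n) * Real.sqrt S.card) := by gcongr
          _ = lam * (Real.sqrt S.card * Real.sqrt S.card) * D ^ n := by ring
          _ = _ := by rw [hss]
      have h10 : (n : ℝ) * lam * S.card * D ^ (n - 1) * (c * S.card) ≤
          n * lam * S.card * D ^ n := by
        rcases n with _ | m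
        · simp
        · have : D ^ (m + 1) = D ^ m * D := pow_succ _ _
          rw [Nat.add_sub_cancel, this]
          have h := mul_le_mul_of_nonneg_left hcD (by positivity :
            0 ≤ ((m + 1 : ℕ) : ℝ) * lam * S.card * D ^ m)
          linarith
      have hP : 0 ≤ c * (S.card : ℝ) := by positivity
      rw [Nat.add_sub_cancel]
      push_cast
      have h11 := mul_le_mul_of_nonneg_right ih2 hP
      rw [← abs_of_nonneg hP, ← abs_mul, abs_of_nonneg hP] at h11
      calc |total R S T - S.card * (c * S.card) ^ (n + 1)|
          = |(total R S T - total R S T' * (c * S.card)) +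
            (total R S T' - S.card * (c * S.card) ^ n) * (c * S.card)| := by congr 1; ring
        _ ≤ _ := abs_add_le _ _
        _ ≤ lam * S.card * D ^ n + n * lam * S.card * D ^ n := add_le_add h9 (h11.trans h10)
        _ = _ := by ring
end
end KT

namespace KT

lemma num_aux (n : ℕ) (y : ℝ) (hy0 : 0 < y) (hy : y ^ 2 = 1 / 2) :
    ((n : ℝ) + 1) * y ^ n * (1 + y ^ n) ^ n + ((n : ℝ) + 2) / 4 ^ (n + 1) ≤ 4 := by
  have hy7 : y ≤ 0.7072 := by nlinarith
  have hmono : ∀ W : ℝ, y ^ n ≤ W → ((n : ℝ) + 1) * y ^ n * (1 + y ^ n) ^ n ≤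
      ((n : ℝ) + 1) * W * (1 + W) ^ n := by
    intro W hW
    have : 0 < y ^ n := by positivity
    have : 0 < W := lt_of_lt_of_le this hW
    gcongr
  have h3 : y ^ 3 = y / 2 := by rw [pow_succ, hy]; ring
  have h4 : y ^ 4 = 1 / 4 := by
    rw [show (4 : ℕ) = 2 * 2 from rfl, pow_mul, hy]; norm_num
  have h5 : y ^ 5 = y / 4 := by rw [pow_succ, h4]; ring
  have h6 : y ^ 6 = 1 / 8 := by
    have : y ^ 6 = (y ^ 2) ^ 3 := by ring
    rw [this, hy]; norm_num
  by_cases hn : n < 6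
  · interval_cases n
    · norm_num
    · have := hmono 0.7072 (by simpa using hy7)
      norm_num at this ⊢; linarith
    · have := hmono 0.5 (by rw [hy]; norm_num)
      norm_num at this ⊢; linarith
    · have := hmono 0.3536 (by rw [h3]; linarith)
      norm_num at this ⊢; linarith
    · have := hmono 0.25 (by rw [h4]; norm_num)
      norm_num at this ⊢; linarith
    · have := hmono 0.1768 (by rw [h5]; linarith)
      norm_num at this ⊢; linarith
  · have hn6 : 6 ≤ n := by omega
    have hw : ((n : ℝ) + 1) * y ^ n ≤ 7 / 8 := by
      clear hmono
      induction n, hn6 using Nat.le_induction with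
      | base => rw [h6]; norm_num
      | succ m hm ih =>
        have hmm := ih (by omega)
        have h0 : 0 < y ^ m := by positivity
        have hm' : (6 : ℝ) ≤ m := by exact_mod_cast hm
        rw [pow_succ]; push_cast
        have : ((m : ℝ) + 1 + 1) * y ≤ m + 1 := by nlinarith
        nlinarith
    have h0 : 0 < y ^ n := by positivity
    have he : (1 + y ^ n) ^ n ≤ 2.7182818286 := by
      calc (1 + y ^ n) ^ n ≤ (Real.exp (y ^ n)) ^ n := by
            apply pow_le_pow_left₀ (by positivity)
            linarith [Real.add_one_le_exp (y ^ n)]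
        _ = Real.exp (n * y ^ n) := by rw [← Real.exp_nat_mul]
        _ ≤ Real.exp 1 := by
            apply Real.exp_le_exp.2
            nlinarith
        _ ≤ _ := Real.exp_one_lt_d9.le
    have h4n : ((n : ℝ) + 2) / 4 ^ (n + 1) ≤ 1 := by
      rw [div_le_one (by positivity)]
      have : n + 1 < 4 ^ (n + 1) := Nat.lt_pow_self (by norm_num)
      exact_mod_cast (by omega : n + 2 ≤ 4 ^ (n + 1))
    have h8 : ((n : ℝ) + 1) * y ^ n * (1 + y ^ n) ^ n ≤ 7 / 8 * 2.7182818286 := by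
      gcongr
    norm_num at h8 ⊢
    linarith

lemma sum_adj {X : Type} [Fintype X] [DecidableEq X] (R : X → X → Prop) [DecidableRel R]
    (E : Finset X) (u : X) (hu : u ∈ E) :
    ∑ v, adj R E u v = ∑ v, (if v ∈ E then (1 : ℝ) else 0) * (if R u v then 1 else 0) := by
  refine Finset.sum_congr rfl fun v _ => ?_
  unfold adj
  by_cases hv : v ∈ E <;> by_cases huv : R u v <;> simp [hu, hv, huv]

lemma adj_mono {X : Type} (R : X → X → Prop) {S E : Finset X} (hSE : S ⊆ E) (u v : X) :
    adj R S u v ≤ adj R E u v := by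
  unfold adj
  split_ifs with h1 h2
  · exact le_rfl
  · exact absurd ⟨hSE h1.1, hSE h1.2.1, h1.2.2⟩ h2
  · norm_num
  · exact le_rfl

lemma total_nonneg {X V : Type} [Fintype X] [Fintype V] [DecidableEq V] [DecidableEq X]
    (R : X → X → Prop) (S : Finset X) (T : SimpleGraph V) : 0 ≤ total R S T :=
  Finset.sum_nonneg fun _ _ => homInd_nonneg _ _

set_option maxHeartbeats 1600000 in
theorem core {X : Type} [Fintype X] [DecidableEq X] (R : X → X → Prop) [DecidableRel R]
    (hR : ∀ x y, R x y → R y x) (q σ lam : ℝ) (hq : 0 < q) (hσ : 0 < σ) (hlam : 0 ≤ lam)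
    (hσ2 : σ ^ 2 < 1 / 2) (n : ℕ) (E : Finset X) (hE : 0 < E.card)
    (hl : lam ≤ 2 * σ ^ (n + 2) * (E.card / q))
    (hspec : ∀ f₁ f₂ : X → ℝ, |∑ x, ∑ y, f₁ x * f₂ y * ((if R x y then 1 else 0) - 1 / q)| ≤
      lam * (Real.sqrt (∑ x, f₁ x ^ 2) * Real.sqrt (∑ x, f₂ x ^ 2)))
    {V : Type} [Fintype V] [DecidableEq V] (T : SimpleGraph V) (hT : T.IsTree)
    (hV : Fintype.card V = n + 2) :
    ∃ E' ⊆ E, ((E \ E').card : ℝ) ≤ 2 * σ ^ 2 * E.card ∧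
      |total R E' T - E.card * (E.card / q) ^ (n + 1)| ≤
        8 * (E.card * (E.card / q) ^ (n + 1)) * σ ^ 2 := by
  set N : ℝ := (E.card : ℝ) with hN
  have hN0 : 0 < N := by rw [hN]; exact_mod_cast hE
  set K : ℝ := N / q with hK
  have hK0 : 0 < K := by positivity
  obtain ⟨y, hy0, hy⟩ : ∃ y : ℝ, 0 < y ∧ y ^ 2 = 1 / 2 :=
    ⟨Real.sqrt (1 / 2), by positivity, Real.sq_sqrt (by norm_num)⟩
  have hσy : σ ≤ y := by
    apply le_of_lt
    apply lt_of_pow_lt_pow_left₀ 2 hy0.le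
    rw [hy]; exact hσ2
  set w : ℝ := y ^ n with hw
  have hw0 : 0 < w := by positivity
  have hw2 : w ^ 2 * 2 ^ n = 1 := by
    rw [hw, ← pow_mul, mul_comm n 2, pow_mul, hy, ← mul_pow]; norm_num
  set D : ℝ := (1 + w) * K with hD
  set E' : Finset X := E.filter (fun x => ∑ v, adj R E x v ≤ D) with hE'
  have hsub : E' ⊆ E := Finset.filter_subset _ _
  set B := E \ E' with hB
  have hBE : ∀ x ∈ B, x ∈ E ∧ D < ∑ v, adj R E x v := by
    intro x hx
    rw [hB, Finset.mem_sdiff, hE', Finset.mem_filter] at hx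
    refine ⟨hx.1, ?_⟩
    by_contra hcon
    exact hx.2 ⟨hx.1, not_lt.1 hcon⟩
  have hBb : (B.card : ℝ) * w ^ 2 ≤ 4 * (σ ^ 2) ^ (n + 2) * N := by
    have h1 := hspec (fun x => if x ∈ B then 1 else 0) (fun x => if x ∈ E then 1 else 0)
    have h2 : ∑ x, (if x ∈ B then (1 : ℝ) else 0) ^ 2 = B.card := by simp
    have h3 : ∑ x, (if x ∈ E then (1 : ℝ) else 0) ^ 2 = N := by simp [hN]
    rw [h2, h3] at h1
    have h4 : (B.card : ℝ) * (w * K) ≤ ∑ x, ∑ y, (if x ∈ B then (1 : ℝ) else 0) *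
        (if y ∈ E then 1 else 0) * ((if R x y then 1 else 0) - 1 / q) := by
      have e1 : (B.card : ℝ) * (w * K) = ∑ x, if x ∈ B then w * K else 0 := by simp
      rw [e1]
      refine Finset.sum_le_sum fun x _ => ?_
      by_cases hx : x ∈ B
      · obtain ⟨hxE, hxD⟩ := hBE x hx
        rw [sum_adj R E x hxE] at hxD
        have e2 : ∑ y, (if x ∈ B then (1 : ℝ) else 0) *
            (if y ∈ E then 1 else 0) * ((if R x y then 1 else 0) - 1 / q) =
            (∑ v, (if v ∈ E then (1 : ℝ) else 0) * (if R x v then 1 else 0)) - K := by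
          simp only [hx, if_true, one_mul, mul_sub, Finset.sum_sub_distrib]
          congr 1
          rw [← Finset.sum_mul, hK, hN]; simp [div_eq_mul_inv]
        rw [e2, if_pos hx]
        have : D = K + w * K := by rw [hD]; ring
        linarith
      · simp [hx]
    have h5 : (B.card : ℝ) * (w * K) ≤ lam * (Real.sqrt B.card * Real.sqrt N) :=
      h4.trans ((le_abs_self _).trans h1)
    set b := Real.sqrt (B.card : ℝ) with hb
    set s := Real.sqrt N with hs
    have hbb : b ^ 2 = B.card := Real.sq_sqrt (by positivity)
    have hsn : s ^ 2 = N := Real.sq_sqrt hN0.le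
    have hs0 : 0 < s := Real.sqrt_pos.2 hN0
    have hb0 : 0 ≤ b := Real.sqrt_nonneg _
    have h6 : b * w ≤ 2 * σ ^ (n + 2) * s := by
      rcases hb0.eq_or_lt with h | h
      · rw [← h, zero_mul]; positivity
      · have h7 : b * K * (b * w) ≤ b * K * (2 * σ ^ (n + 2) * s) := by
          calc b * K * (b * w) = (B.card : ℝ) * (w * K) := by rw [← hbb]; ring
            _ ≤ lam * (b * s) := h5
            _ ≤ (2 * σ ^ (n + 2) * K) * (b * s) := by gcongr
            _ = _ := by ring
        exact le_of_mul_le_mul_left h7 (by positivity)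
    have h8 := pow_le_pow_left₀ (by positivity) h6 2
    calc (B.card : ℝ) * w ^ 2 = (b * w) ^ 2 := by rw [mul_pow, hbb]
      _ ≤ _ := h8
      _ = _ := by rw [mul_pow, mul_pow, hsn, ← pow_mul, ← pow_mul, mul_comm (n + 2)]; norm_num
  have hBk : (B.card : ℝ) ≤ 2 * σ ^ 2 * (2 * σ ^ 2) ^ (n + 1) * N := by
    have h2n : (0 : ℝ) < 2 ^ n := by positivity
    calc (B.card : ℝ) = (B.card * w ^ 2) * 2 ^ n := by rw [mul_assoc, hw2, mul_one]
      _ ≤ (4 * (σ ^ 2) ^ (n + 2) * N) * 2 ^ n := by gcongr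
      _ = _ := by rw [mul_pow]; ring
  have hδ0 : 0 < σ ^ 2 := by positivity
  refine ⟨E', hsub, ?_, ?_⟩
  · refine hBk.trans ?_
    have : (2 * σ ^ 2) ^ (n + 1) ≤ 1 := pow_le_one₀ (by positivity) (by linarith)
    have h2 : 0 ≤ 2 * σ ^ 2 * N := by positivity
    nlinarith [mul_le_mul_of_nonneg_left this h2]
  set m : ℝ := (E'.card : ℝ) with hm
  have hmN : m ≤ N := by rw [hm, hN]; exact_mod_cast Finset.card_le_card hsub
  have hmB : m = N - B.card := by
    have := Finset.card_sdiff_add_card_eq_card hsub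
    rw [hm, hN, ← this, hB]; push_cast; ring
  have hm0 : 0 ≤ m := by positivity
  have hDeg : ∀ u, ∑ v, adj R E' u v ≤ D := by
    intro u
    by_cases hu : u ∈ E'
    · exact (Finset.sum_le_sum fun v _ => adj_mono R hsub u v).trans (Finset.mem_filter.1 hu).2
    · have : ∑ v, adj R E' u v = 0 := Finset.sum_eq_zero fun v _ => by
        unfold adj; simp [hu]
      rw [this]; positivity
  have hKm : 1 / q * m ≤ K := by
    rw [hK, one_div_mul_eq_div]; gcongr
  have hKD : K ≤ D := by rw [hD]; nlinarith
  have htc := (tree_count (S := E') hR (1 / q) lam D (by positivity) hlam hDeg (hKm.trans hKD)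
    hspec (n + 1) V T hT hV).2
  rw [← hm] at htc
  set A : ℝ := ((n : ℝ) + 1) * w * (1 + w) ^ n with hA
  have hnum : A + ((n : ℝ) + 2) / 4 ^ (n + 1) ≤ 4 := num_aux n y hy0 hy
  have hA4 : A ≤ 4 := by
    have : 0 ≤ ((n : ℝ) + 2) / 4 ^ (n + 1) := by positivity
    linarith
  set P : ℝ := N * K ^ (n + 1) with hP
  have hP0 : 0 < P := by positivity
  have herr : ((n + 1 : ℕ) : ℝ) * lam * m * D ^ (n + 1 - 1) ≤ P * (2 * σ ^ 2 * A) := by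
    rw [Nat.add_sub_cancel]; push_cast
    calc ((n : ℝ) + 1) * lam * m * D ^ n ≤
          ((n : ℝ) + 1) * (2 * σ ^ (n + 2) * K) * N * D ^ n := by gcongr
      _ = P * (2 * σ ^ 2 * (((n : ℝ) + 1) * σ ^ n * (1 + w) ^ n)) := by
          rw [hP, hD, mul_pow]; ring
      _ ≤ _ := by
          rw [hA, hw]; gcongr
  have habs := htc.trans herr
  rw [abs_le] at habs
  have hmain_le : m * (1 / q * m) ^ (n + 1) ≤ P := by
    rw [hP]
    exact mul_le_mul hmN (pow_le_pow_left₀ (by positivity) hKm _) (by positivity) hN0.le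
  rw [abs_le]
  constructor
  · by_cases h8 : 1 ≤ 8 * σ ^ 2
    · have := total_nonneg R E' T
      nlinarith
    · have h8' : 2 * σ ^ 2 ≤ 1 / 4 := by linarith
      set κ : ℝ := B.card / N with hκ
      have hκ0 : 0 ≤ κ := by positivity
      have hκ1 : κ ≤ 1 := by
        rw [hκ, div_le_one hN0]; linarith
      have hκb : κ ≤ 2 * σ ^ 2 / 4 ^ (n + 1) := by
        rw [hκ, div_le_iff₀ hN0]
        refine hBk.trans ?_
        have : (2 * σ ^ 2) ^ (n + 1) ≤ (1 / 4) ^ (n + 1) := by gcongr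
        rw [div_eq_mul_inv, ← inv_pow, ← one_div]
        gcongr
      have hmk : m = N * (1 - κ) := by rw [hmB, hκ]; field_simp
      have hmain : m * (1 / q * m) ^ (n + 1) = P * (1 - κ) ^ (n + 2) := by
        rw [hmk, hP, hK, one_div_mul_eq_div, mul_div_right_comm, mul_pow]; ring
      have hbern : 1 - ((n : ℝ) + 2) * κ ≤ (1 - κ) ^ (n + 2) := by
        have := one_add_mul_le_pow (a := -κ) (by linarith) (n + 2)
        push_cast at this
        rw [← sub_eq_add_neg] at this
        linarith
      have h9 : ((n : ℝ) + 2) * κ ≤ 2 * σ ^ 2 * (((n : ℝ) + 2) / 4 ^ (n + 1)) := by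
        calc ((n : ℝ) + 2) * κ ≤ ((n : ℝ) + 2) * (2 * σ ^ 2 / 4 ^ (n + 1)) := by gcongr
          _ = _ := by ring
      have h10 : ((n : ℝ) + 2) * κ + 2 * σ ^ 2 * A ≤ 8 * σ ^ 2 := by
        nlinarith [mul_le_mul_of_nonneg_left hnum (by positivity : 0 ≤ 2 * σ ^ 2)]
      have h11 := habs.1
      rw [hmain] at h11
      have h12 := mul_le_mul_of_nonneg_left hbern hP0.le
      have h13 := mul_le_mul_of_nonneg_left h10 hP0.le
      nlinarith
  · have h11 := habs.2
    have h12 : P * (2 * σ ^ 2 * A) ≤ P * (2 * σ ^ 2 * 4) := by gcongr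
    nlinarith

lemma card_total {X V : Type} [Fintype X] [Fintype V] [DecidableEq V] [DecidableEq X]
    (R : X → X → Prop) (S : Finset X) (T : SimpleGraph V) :
    (Nat.card {x : V → X // (∀ i, x i ∈ S) ∧ ∀ i j, T.Adj i j → R (x i) (x j)} : ℝ) =
      total R S T := by
  classical
  rw [Nat.card_eq_fintype_card, Fintype.card_subtype]
  unfold total homInd
  rw [Finset.card_filter]
  push_cast
  refine Finset.sum_congr rfl fun x _ => ?_
  congr

end KT

theorem stmt10 (q d r : ℕ) (hd : 2 ≤ d)
    (F : Type) [Field F] [Fintype F] [DecidableEq F]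
    (hq : Fintype.card F = q) (hodd : Odd q)
    (Q : QuadraticForm F (Fin d → F))
    (hQ : ∀ x, (∀ y, QuadraticMap.polar (⇑Q) x y = 0) → x = 0)
    (t : F) (ht : t ≠ 0)
    (T : SimpleGraph (Fin (r + 1))) (hT : T.Connected) (hT' : T.IsAcyclic)
    (ε : ℝ) (hε : 0 < ε)
    (E : Finset (Fin d → F))
    (hE : (E.card : ℝ) > (q : ℝ) ^ (((d : ℝ) + 1) / 2 + ε)) :
    ∃ E' : Finset (Fin d → F), E' ⊆ E ∧
      ((E \ E').card : ℝ) ≤ 2 * (q : ℝ) ^ (-(2 * ε) / ((r : ℝ) + 1)) * (E.card : ℝ) ∧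
      |(Nat.card {x : Fin (r + 1) → (Fin d → F) // (∀ i, x i ∈ E') ∧
          ∀ i j, T.Adj i j → Q (x i - x j) = t} : ℝ) -
          (E.card : ℝ) ^ (r + 1) / (q : ℝ) ^ r| ≤
        8 * ((E.card : ℝ) ^ (r + 1) / (q : ℝ) ^ r) *
          (q : ℝ) ^ (-(2 * ε) / ((r : ℝ) + 1)) := by
  have hq0 : 0 < (q : ℝ) := by
    rw [← hq]; exact_mod_cast Fintype.card_pos
  set R : (Fin d → F) → (Fin d → F) → Prop := fun x y => Q (x - y) = t with hRdef
  let _ : DecidableRel R := fun x y => inferInstanceAs (Decidable (Q (x - y) = t))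
  have hR : ∀ x y, R x y → R y x := by
    intro x y h
    change Q (y - x) = t
    rw [← neg_sub, QuadraticMap.map_neg]; exact h
  have hcard : ∀ S : Finset (Fin d → F),
      (Nat.card {x : Fin (r + 1) → (Fin d → F) // (∀ i, x i ∈ S) ∧
          ∀ i j, T.Adj i j → Q (x i - x j) = t} : ℝ) = KT.total R S T :=
    fun S => KT.card_total R S T
  simp only [hcard]
  set σ : ℝ := (q : ℝ) ^ (-ε / ((r : ℝ) + 1)) with hσ
  have hσ0 : 0 < σ := Real.rpow_pos_of_pos hq0 _
  have hr1 : ((r : ℝ) + 1) ≠ 0 := by positivity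
  have hδ : (q : ℝ) ^ (-(2 * ε) / ((r : ℝ) + 1)) = σ ^ 2 := by
    rw [hσ, ← Real.rpow_natCast, ← Real.rpow_mul hq0.le]
    congr 1; push_cast; ring
  have hσr : σ ^ (r + 1) = (q : ℝ) ^ (-ε) := by
    rw [hσ, ← Real.rpow_natCast, ← Real.rpow_mul hq0.le]
    congr 1; push_cast; field_simp
  rw [hδ]
  have hE0R : (0 : ℝ) < E.card := lt_trans (Real.rpow_pos_of_pos hq0 _) hE
  have hE0 : 0 < E.card := by exact_mod_cast hE0R
  have hP : (E.card : ℝ) ^ (r + 1) / (q : ℝ) ^ r = E.card * (E.card / q) ^ r := by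
    rw [div_pow]; ring
  rw [hP]
  have hP0 : 0 < (E.card : ℝ) * (E.card / q) ^ r := by positivity
  set lam : ℝ := 2 * Real.sqrt q ^ d / Real.sqrt q with hlam
  have hlam0 : 0 ≤ lam := by positivity
  have hspec : ∀ f₁ f₂ : (Fin d → F) → ℝ,
      |∑ x, ∑ y, f₁ x * f₂ y * ((if R x y then 1 else 0) - 1 / (q : ℝ))| ≤
      lam * (Real.sqrt (∑ x, f₁ x ^ 2) * Real.sqrt (∑ x, f₂ x ^ 2)) := by
    intro f₁ f₂
    have := KT.spectral (by rw [hq]; exact hodd) Q hQ t ht f₁ f₂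
    rw [hq] at this
    exact this
  by_cases hbig : 1 / 2 ≤ σ ^ 2
  · refine ⟨∅, by simp, ?_, ?_⟩
    · simp only [Finset.sdiff_empty]; nlinarith
    · have : KT.total R ∅ T = 0 := by
        unfold KT.total
        refine Finset.sum_eq_zero fun x _ => ?_
        unfold KT.homInd
        rw [if_neg]
        intro h
        simpa using h.1 0
      rw [this, zero_sub, abs_neg, abs_of_pos hP0]
      nlinarith
  rcases r with _ | n
  · refine ⟨E, le_rfl, ?_, ?_⟩
    · simp; positivity
    · have hsn : 0 ≤ ∑ u, ∑ v, KT.adj R E u v :=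
        Finset.sum_nonneg fun u _ => Finset.sum_nonneg fun v _ => KT.adj_nonneg u v
      have hcn : 0 ≤ 1 / (q : ℝ) * E.card := by positivity
      have := (KT.tree_count (S := E) hR (1 / (q : ℝ)) lam
        ((∑ u, ∑ v, KT.adj R E u v) + 1 / (q : ℝ) * E.card) (by positivity) hlam0
        (fun u => by
          have := Finset.single_le_sum (f := fun u => ∑ v, KT.adj R E u v)
            (fun u _ => Finset.sum_nonneg fun v _ => KT.adj_nonneg u v) (Finset.mem_univ u)
          linarith)
        (by linarith) hspec 0 (Fin (0 + 1)) T ⟨hT, hT'⟩ (by simp)).2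
      simp only [pow_zero, mul_one, Nat.cast_zero, zero_mul] at this ⊢
      exact this.trans (by positivity)
  · have hl : lam ≤ 2 * σ ^ (n + 2) * (E.card / q) := by
      rw [hσr]
      have hsq : Real.sqrt (q : ℝ) ^ (d + 1) = (q : ℝ) ^ (((d : ℝ) + 1) / 2) := by
        rw [Real.sqrt_eq_rpow, ← Real.rpow_natCast, ← Real.rpow_mul hq0.le]
        congr 1; push_cast; ring
      have hs0 : 0 < Real.sqrt (q : ℝ) := Real.sqrt_pos.2 hq0
      have hss : Real.sqrt (q : ℝ) * Real.sqrt q = q := Real.mul_self_sqrt hq0.le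
      have h1 : Real.sqrt (q : ℝ) ^ (d + 1) ≤ (q : ℝ) ^ (-ε) * E.card := by
        calc Real.sqrt (q : ℝ) ^ (d + 1)
            = (q : ℝ) ^ (-ε) * (q : ℝ) ^ (((d : ℝ) + 1) / 2 + ε) := by
              rw [hsq, ← Real.rpow_add hq0]; congr 1; ring
          _ ≤ _ := by
              apply mul_le_mul_of_nonneg_left hE.le (Real.rpow_pos_of_pos hq0 _).le
      have h2 : lam = 2 * Real.sqrt (q : ℝ) ^ (d + 1) / q := by
        rw [hlam, div_eq_div_iff hs0.ne' hq0.ne']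
        linear_combination (-2) * Real.sqrt (q : ℝ) ^ d * hss
      rw [h2, mul_div_assoc', div_le_div_iff_of_pos_right hq0]
      linarith
    obtain ⟨E', h1, h2, h3⟩ := KT.core R hR q σ lam hq0 hσ0 hlam0 (not_le.1 hbig) n E hE0 hl hspec T
      ⟨hT, hT'⟩ (by simp)
    exact ⟨E', h1, h2, h3⟩
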